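/- Let F = (X_n, K_n, π_n)_{n≥1} be a family of irreducible birth and death chains on X_n = {0,1,...,n}. For a ∈ (0,1), let M_n(a) ∈ X_n satisfy π_n([0,M_n(a)]) ≥ a and π_n([M_n(a),n]) ≥ 1−a, let λ_n(a) be the smallest eigenvalue of the principal submatrix of I − K_n indexed by 0,...,M_n(a)−1, and set u_n(a) = E_0 τ^{(n)}_{M_n(a)} and w_n(a)² = Var_0 τ^{(n)}_{M_n(a)}, where τ^{(n)}_i is the discrete-time hitting time. Assume π_n(0) → 0, inf_{i,n} K_n(i,i) > 0, and u_n(a) → ∞ for some a ∈ (0,1). Then for the family F^L of the chains started at 0 the following are equivalent: (1) F^L has a total variation cutoff; (2) u_n(a)/w_n(a) → ∞ for all a ∈ (0,1); (3) u_n(a)λ_n(a) → ∞ for all a ∈ (0,1); (4) there exist a ∈ (0,1) and a positive sequence (t_n) with t_n = O(u_n(c)) for all c ∈ (0,1) such that P_0(τ^{(n)}_{M_n(a)} > (1−ε)t_n) → 1 for all ε ∈ (0,1), and for every b ∈ (a,1) there is α_b ∈ (0,1) with limsup_n P_0(τ^{(n)}_{M_n(b)} > (1+ε)t_n) ≤ α_b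 for all ε > 0. Under (2) or (3) the cutoff time can be taken to be u_n(a) for any a ∈ (0,1); under (4) it can be taken to be (t_n). -/

import Mathlib

open scoped BigOperators
open Filter Matrix Polynomial MeasureTheory

noncomputable section

/-- An irreducible birth and death chain on `{0,1,...,n}`, together with its
(unique) stationary distribution. -/
structure BDChain (n : ℕ) where
  K : Matrix (Fin (n + 1)) (Fin (n + 1)) ℝ
  pi : Fin (n + 1) → ℝ
  K_nonneg : ∀ i j, 0 ≤ K i j
  K_rowSum : ∀ i, ∑ j, K i j = 1
  K_tridiag : ∀ i j : Fin (n + 1), 1 < |(i : ℤ) - (j : ℤ)| → K i j = 0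
  K_irred : ∀ i : ℕ, ∀ h : i < n,
    0 < K ⟨i, by omega⟩ ⟨i + 1, by omega⟩ ∧ 0 < K ⟨i + 1, by omega⟩ ⟨i, by omega⟩
  pi_pos : ∀ i, 0 < pi i
  pi_sum : ∑ i, pi i = 1
  pi_stat : ∀ j, ∑ i, pi i * K i j = pi j

namespace BDChain

variable {n : ℕ}

/-- `π([0,M])` -/
def piLow (c : BDChain n) (M : Fin (n + 1)) : ℝ :=
  ∑ ℓ : Fin (n + 1), if ℓ ≤ M then c.pi ℓ else 0

/-- `π([M,n])` -/
def piHigh (c : BDChain n) (M : Fin (n + 1)) : ℝ :=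
  ∑ ℓ : Fin (n + 1), if M ≤ ℓ then c.pi ℓ else 0

/-- `π([a,b])` -/
def piInt (c : BDChain n) (a b : Fin (n + 1)) : ℝ :=
  ∑ ℓ : Fin (n + 1), if a ≤ ℓ ∧ ℓ ≤ b then c.pi ℓ else 0

/-- The substochastic matrix of the chain killed at state `i`. -/
def killed (c : BDChain n) (i : Fin (n + 1)) : Matrix (Fin (n + 1)) (Fin (n + 1)) ℝ :=
  Matrix.of fun x y => if x = i ∨ y = i then 0 else c.K x y

/-- `P_j(τ_i > m)`, where `τ_i` is the discrete-time hitting time of state `i`. -/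
def hitSurv (c : BDChain n) (i j : Fin (n + 1)) (m : ℕ) : ℝ :=
  if j = i then 0 else ∑ y, (c.killed i ^ m) j y

/-- `P_j(τ̃_i > t)`, where `τ̃_i` is the continuous-time hitting time of state `i`. -/
def hitSurvC (c : BDChain n) (i j : Fin (n + 1)) (t : ℝ) : ℝ :=
  ∑' m : ℕ, (Real.exp (-t) * t ^ m / m.factorial) * c.hitSurv i j m

/-- `E_j τ_i` -/
def hitMean (c : BDChain n) (i j : Fin (n + 1)) : ℝ :=
  ∑' m : ℕ, c.hitSurv i j m

/-- `Var_j τ_i` -/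
def hitVar (c : BDChain n) (i j : Fin (n + 1)) : ℝ :=
  (∑' m : ℕ, (2 * (m : ℝ) + 1) * c.hitSurv i j m) - (c.hitMean i j) ^ 2

/-- `E_j τ̃_i` -/
def hitMeanC (c : BDChain n) (i j : Fin (n + 1)) : ℝ :=
  ∫ t in Set.Ioi (0 : ℝ), c.hitSurvC i j t

/-- `Var_j τ̃_i` -/
def hitVarC (c : BDChain n) (i j : Fin (n + 1)) : ℝ :=
  (∫ t in Set.Ioi (0 : ℝ), 2 * t * c.hitSurvC i j t) - (c.hitMeanC i j) ^ 2

/-- The substochastic matrix of the chain killed at states `i` and `k`. -/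
def killed2 (c : BDChain n) (i k : Fin (n + 1)) : Matrix (Fin (n + 1)) (Fin (n + 1)) ℝ :=
  Matrix.of fun x y => if x = i ∨ x = k ∨ y = i ∨ y = k then 0 else c.K x y

/-- `P_j(min{τ_i, τ_k} > m)` -/
def hitSurv2 (c : BDChain n) (i k j : Fin (n + 1)) (m : ℕ) : ℝ :=
  if j = i ∨ j = k then 0 else ∑ y, (c.killed2 i k ^ m) j y

/-- `E_j min{τ_i, τ_k}` -/
def hitMean2 (c : BDChain n) (i k j : Fin (n + 1)) : ℝ :=
  ∑' m : ℕ, c.hitSurv2 i k j m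

/-- `E_j min{τ̃_i, τ̃_k}` -/
def hitMean2C (c : BDChain n) (i k j : Fin (n + 1)) : ℝ :=
  ∫ t in Set.Ioi (0 : ℝ),
    ∑' m : ℕ, (Real.exp (-t) * t ^ m / m.factorial) * c.hitSurv2 i k j m

/-- The continuous-time kernel `H_t(x,y) = e^{-t(I-K)}(x,y)`. -/
def Ht (c : BDChain n) (t : ℝ) (x y : Fin (n + 1)) : ℝ :=
  ∑' m : ℕ, (Real.exp (-t) * t ^ m / m.factorial) * (c.K ^ m) x y

/-- Discrete-time total variation distance from starting state `x` at time `m`. -/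
def dTV (c : BDChain n) (x : Fin (n + 1)) (m : ℕ) : ℝ :=
  ⨆ A : Finset (Fin (n + 1)), (∑ y ∈ A, (c.K ^ m) x y - ∑ y ∈ A, c.pi y)

/-- Continuous-time total variation distance from starting state `x` at time `t`. -/
def dTVC (c : BDChain n) (x : Fin (n + 1)) (t : ℝ) : ℝ :=
  ⨆ A : Finset (Fin (n + 1)), (∑ y ∈ A, c.Ht t x y - ∑ y ∈ A, c.pi y)

/-- Maximum (over starting states) discrete-time total variation distance. -/
def dTVMax (c : BDChain n) (m : ℕ) : ℝ := ⨆ x, c.dTV x m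

/-- Maximum (over starting states) continuous-time total variation distance. -/
def dTVMaxC (c : BDChain n) (t : ℝ) : ℝ := ⨆ x, c.dTVC x t

/-- Discrete-time separation from starting state `x` at time `m`. -/
def sep (c : BDChain n) (x : Fin (n + 1)) (m : ℕ) : ℝ :=
  ⨆ y, (1 - (c.K ^ m) x y / c.pi y)

/-- Continuous-time separation from starting state `x` at time `t`. -/
def sepC (c : BDChain n) (x : Fin (n + 1)) (t : ℝ) : ℝ :=
  ⨆ y, (1 - c.Ht t x y / c.pi y)

end BDChain

/-- Discrete-time `ε`-mixing time for a distance profile `d`. -/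
def mixD (d : ℕ → ℝ) (ε : ℝ) : ℕ := sInf {m : ℕ | d m ≤ ε}

/-- Continuous-time `ε`-mixing time for a distance profile `d`. -/
def mixC (d : ℝ → ℝ) (ε : ℝ) : ℝ := sInf {t : ℝ | 0 ≤ t ∧ d t ≤ ε}

/-- The set of (real) eigenvalues of a square matrix. -/
def eigSet {ι : Type*} [Fintype ι] (M : Matrix ι ι ℝ) : Set ℝ :=
  {x | ∃ v : ι → ℝ, v ≠ 0 ∧ M.mulVec v = x • v}

/-- `l` is the smallest non-zero eigenvalue of `M`. -/
def IsSmallestNonzeroEig {ι : Type*} [Fintype ι] (M : Matrix ι ι ℝ) (l : ℝ) : Prop :=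
  l ∈ eigSet M ∧ l ≠ 0 ∧ ∀ x ∈ eigSet M, x ≠ 0 → l ≤ x

/-- `l` is the smallest eigenvalue of `M`. -/
def IsSmallestEig {ι : Type*} [Fintype ι] (M : Matrix ι ι ℝ) (l : ℝ) : Prop :=
  l ∈ eigSet M ∧ ∀ x ∈ eigSet M, l ≤ x

/-- The principal submatrix of `I - K` indexed by the states `0, 1, ..., M-1`. -/
def BDChain.subIK {n : ℕ} (c : BDChain n) (M : Fin (n + 1)) :
    Matrix (Fin (M : ℕ)) (Fin (M : ℕ)) ℝ :=
  Matrix.of fun a b =>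
    (1 - c.K) (Fin.castLE M.isLt.le a) (Fin.castLE M.isLt.le b)

/-- A family of chains, with `ε ↦ n ↦ T ε n` the mixing time profile, presents a cutoff
with cutoff time `t`. -/
def cutoffWith (T : ℝ → ℕ → ℝ) (t : ℕ → ℝ) : Prop :=
  ∀ ε ∈ Set.Ioo (0 : ℝ) 1, Filter.Tendsto (fun n => T ε n / t n) Filter.atTop (nhds 1)

/-- A family of chains presents a cutoff. -/
def hasCutoff (T : ℝ → ℕ → ℝ) : Prop :=
  ∃ t : ℕ → ℝ, (∀ n, 0 < t n) ∧ cutoffWith T t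

/-- A family of chains presents a `(t_n, b_n)` cutoff. -/
def cutoffWindow (T : ℝ → ℕ → ℝ) (t b : ℕ → ℝ) : Prop :=
  (∀ᶠ n in Filter.atTop, 0 < t n) ∧ (∀ᶠ n in Filter.atTop, 0 < b n) ∧
  Filter.Tendsto (fun n => b n / t n) Filter.atTop (nhds 0) ∧
  ∀ ε ∈ Set.Ioo (0 : ℝ) 1, ∃ C : ℝ, ∀ᶠ n in Filter.atTop, |T ε n - t n| ≤ C * b n

/-! ### Tails of sequences -/

/-- `c² + ∑_{k<K} (2k+1-2c) s_k`, which is `E (min τ K - c)²` when `s_k = P(τ > k)`. -/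
def truncSqDev (s : ℕ → ℝ) (c : ℝ) (K : ℕ) : ℝ :=
  c ^ 2 + ∑ k ∈ Finset.range K, s k * (2 * (k : ℝ) + 1 - 2 * c)

lemma truncSqDev_succ (s : ℕ → ℝ) (c : ℝ) (K : ℕ) :
    truncSqDev s c (K + 1) =
      truncSqDev s c K + s K * ((((K + 1 : ℕ) : ℝ) - c) ^ 2 - ((K : ℝ) - c) ^ 2) := by
  simp only [truncSqDev, Finset.sum_range_succ]
  push_cast
  ring

lemma tendsto_truncSqDev {s : ℕ → ℝ} (hs : Summable s)
    (hs2 : Summable fun m : ℕ => (2 * (m : ℝ) + 1) * s m) (c : ℝ) :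
    Tendsto (truncSqDev s c) atTop
      (nhds (c ^ 2 + ((∑' m : ℕ, (2 * (m : ℝ) + 1) * s m) - 2 * c * ∑' m, s m))) := by
  have h := (hs2.hasSum.sub (hs.hasSum.mul_left (2 * c))).tendsto_sum_nat
  refine (tendsto_const_nhds (x := c ^ 2)).add (h.congr fun K => ?_)
  exact Finset.sum_congr rfl fun k _ => by ring

section Chebyshev

variable {s : ℕ → ℝ}

lemma mul_sq_le_truncSqDev (h1 : ∀ m, s m ≤ 1) (hanti : Antitone s)
    (c : ℝ) (K : ℕ) : s K * ((K : ℝ) - c) ^ 2 ≤ truncSqDev s c K := by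
  induction K with
  | zero => simp only [truncSqDev]; simp; nlinarith [h1 0, sq_nonneg c]
  | succ K ih =>
    rw [truncSqDev_succ]
    have := mul_le_mul_of_nonneg_right (hanti (Nat.le_succ K)) (sq_nonneg (((K + 1 : ℕ) : ℝ) - c))
    simp only [Nat.succ_eq_add_one] at this
    linarith

lemma sq_le_truncSqDev (h1 : ∀ m, s m ≤ 1) {c : ℝ} (K : ℕ) (hK : (K : ℝ) ≤ c) :
    ((K : ℝ) - c) ^ 2 ≤ truncSqDev s c K := by
  induction K with
  | zero => simp [truncSqDev]
  | succ K ih =>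
    rw [truncSqDev_succ]
    push_cast at hK ⊢
    have := ih (by linarith)
    nlinarith [h1 K]

lemma lower_tail_le (h0 : ∀ m, 0 ≤ s m) (h1 : ∀ m, s m ≤ 1) (hanti : Antitone s)
    (hs : Summable s) (hs2 : Summable fun m : ℕ => (2 * (m : ℝ) + 1) * s m)
    (m : ℕ) (hm : (m : ℝ) ≤ ∑' k, s k) :
    (1 - s m) * ((∑' k, s k) - m) ^ 2 ≤
      (∑' m : ℕ, (2 * (m : ℝ) + 1) * s m) - (∑' k, s k) ^ 2 := by
  set u := ∑' k, s k with hu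
  have key : ∀ j, (1 - s m) * (u - m) ^ 2 + s (m + j) * (((m + j : ℕ) : ℝ) - u) ^ 2 ≤
      truncSqDev s u (m + j) := by
    intro j
    induction j with
    | zero => have := sq_le_truncSqDev h1 m hm; simp; linarith
    | succ j ih =>
      rw [← add_assoc, truncSqDev_succ]
      have := mul_le_mul_of_nonneg_right (hanti (Nat.le_succ (m + j)))
        (sq_nonneg (((m + j + 1 : ℕ) : ℝ) - u))
      simp only [Nat.succ_eq_add_one] at this
      linarith
  have hlim := tendsto_truncSqDev hs hs2 u
  have : (1 - s m) * (u - m) ^ 2 ≤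
      u ^ 2 + ((∑' m : ℕ, (2 * (m : ℝ) + 1) * s m) - 2 * u * ∑' m, s m) := by
    refine ge_of_tendsto hlim (eventually_atTop.2 ⟨m, fun K hK => ?_⟩)
    obtain ⟨j, rfl⟩ := Nat.exists_eq_add_of_le hK
    have := mul_nonneg (h0 (m + j)) (sq_nonneg (((m + j : ℕ) : ℝ) - u))
    linarith [key j]
  rw [← hu] at this
  linarith

lemma upper_tail_le (h0 : ∀ m, 0 ≤ s m) (h1 : ∀ m, s m ≤ 1) (hanti : Antitone s)
    (hs : Summable s) (hs2 : Summable fun m : ℕ => (2 * (m : ℝ) + 1) * s m)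
    (m : ℕ) (hm : (∑' k, s k) ≤ (m : ℝ) + 1) :
    s m * ((m : ℝ) + 1 - ∑' k, s k) ^ 2 ≤
      (∑' m : ℕ, (2 * (m : ℝ) + 1) * s m) - (∑' k, s k) ^ 2 := by
  set u := ∑' k, s k with hu
  have key : ∀ j, s m * ((m : ℝ) + 1 - u) ^ 2 ≤ truncSqDev s u (m + 1 + j) := by
    intro j
    induction j with
    | zero =>
      have := mul_sq_le_truncSqDev h1 hanti u m
      rw [add_zero, truncSqDev_succ]
      push_cast
      linarith
    | succ j ih =>
      rw [← add_assoc, truncSqDev_succ]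
      have : 0 ≤ s (m + 1 + j) *
          ((((m + 1 + j + 1 : ℕ) : ℝ) - u) ^ 2 - (((m + 1 + j : ℕ) : ℝ) - u) ^ 2) := by
        refine mul_nonneg (h0 _) ?_
        push_cast
        have : (0 : ℝ) ≤ j := Nat.cast_nonneg j
        nlinarith
      linarith
  have hlim := tendsto_truncSqDev hs hs2 u
  have : s m * ((m : ℝ) + 1 - u) ^ 2 ≤
      u ^ 2 + ((∑' m : ℕ, (2 * (m : ℝ) + 1) * s m) - 2 * u * ∑' m, s m) := by
    refine ge_of_tendsto hlim (eventually_atTop.2 ⟨m + 1, fun K hK => ?_⟩)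
    obtain ⟨j, rfl⟩ := Nat.exists_eq_add_of_le hK
    exact key j
  rw [← hu] at this
  linarith

lemma nat_mul_le_tsum (h0 : ∀ m, 0 ≤ s m) (hanti : Antitone s)
    (hs : Summable s) (m : ℕ) : (m : ℝ) * s m ≤ ∑' k, s k := by
  calc (m : ℝ) * s m = ∑ _k ∈ Finset.range m, s m := by simp
    _ ≤ ∑ k ∈ Finset.range m, s k :=
        Finset.sum_le_sum fun k hk => hanti (Finset.mem_range.1 hk).le
    _ ≤ _ := hs.sum_le_tsum _ fun k _ => h0 k

lemma tsum_mul_le (h1 : ∀ m, s m ≤ 1) (hs : Summable s) (m : ℕ) (hsub : ∀ k, s (k + m) ≤ s m * s k) :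
    (∑' k, s k) * (1 - s m) ≤ m := by
  have e := hs.sum_add_tsum_nat_add m
  have hle : ∑' k, s (k + m) ≤ s m * ∑' k, s k := by
    rw [← tsum_mul_left]
    exact ((summable_nat_add_iff m).2 hs).tsum_le_tsum hsub (hs.mul_left _)
  have : ∑ k ∈ Finset.range m, s k ≤ m := by
    calc _ ≤ ∑ _k ∈ Finset.range m, (1 : ℝ) := Finset.sum_le_sum fun k _ => h1 k
      _ = m := by simp
  linarith

lemma exists_geometric_bound (h0 : ∀ m, 0 ≤ s m) (h1 : ∀ m, s m ≤ 1)
    (hsub : ∀ k m, s (k + m) ≤ s m * s k) {N : ℕ} (hN : 0 < N)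
    (hlt : s N < 1) : ∃ C θ : ℝ, 0 < C ∧ 0 < θ ∧ θ < 1 ∧ ∀ m, s m ≤ C * θ ^ m := by
  obtain ⟨θ, hθ1, hθ0, hθ⟩ : ∃ θ : ℝ, θ < 1 ∧ 0 < θ ∧ s N < θ ^ N := by
    have hc : Tendsto (fun θ : ℝ => θ ^ N) (nhdsWithin 1 (Set.Iio 1)) (nhds (1 ^ N)) :=
      ((continuous_pow N).tendsto 1).mono_left nhdsWithin_le_nhds
    have e1 := hc.eventually (lt_mem_nhds (by simpa using hlt))
    have e2 : ∀ᶠ θ : ℝ in nhdsWithin 1 (Set.Iio 1), 0 < θ :=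
      nhdsWithin_le_nhds (lt_mem_nhds one_pos)
    obtain ⟨θ, ⟨a, b⟩, c⟩ := ((e1.and e2).and self_mem_nhdsWithin).exists
    exact ⟨θ, c, b, a⟩
  refine ⟨(θ ^ N)⁻¹, θ, by positivity, hθ0, hθ1, fun m => ?_⟩
  induction m using Nat.strong_induction_on with
  | _ m ih =>
    rcases lt_or_ge m N with h | h
    · have : θ ^ N ≤ θ ^ m := pow_le_pow_of_le_one hθ0.le hθ1.le h.le
      calc s m ≤ 1 := h1 m
        _ = (θ ^ N)⁻¹ * θ ^ N := by field_simp
        _ ≤ _ := by gcongr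
    · obtain ⟨j, rfl⟩ := Nat.exists_eq_add_of_le' h
      calc s (j + N) ≤ s N * s j := hsub j N
        _ ≤ θ ^ N * ((θ ^ N)⁻¹ * θ ^ j) := by
            gcongr
            · exact h0 _
            · exact ih j (by omega)
        _ = _ := by rw [pow_add]; ring

end Chebyshev

/-! ### Binomial weights -/

/-- The binomial probability `P(Bin(m,p) = k)`. -/
def binW (p : ℝ) (m k : ℕ) : ℝ := (m.choose k : ℝ) * p ^ k * (1 - p) ^ (m - k)

lemma binW_nonneg {p : ℝ} (hp0 : 0 ≤ p) (hp1 : p ≤ 1) (m k : ℕ) : 0 ≤ binW p m k := by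
  have : 0 ≤ 1 - p := by linarith
  unfold binW; positivity

lemma binW_eq_eval (p : ℝ) (m k : ℕ) : binW p m k = (bernsteinPolynomial ℝ m k).eval p := by
  simp [binW, bernsteinPolynomial]

lemma sum_binW (p : ℝ) (m : ℕ) : ∑ k ∈ Finset.range (m + 1), binW p m k = 1 := by
  have := congrArg (Polynomial.eval p) (bernsteinPolynomial.sum ℝ m)
  simpa [Polynomial.eval_finsetSum, binW_eq_eval] using this

lemma sum_binW_sq_dev (p : ℝ) (m : ℕ) :
    ∑ k ∈ Finset.range (m + 1), binW p m k * ((m : ℝ) * p - k) ^ 2 = m * p * (1 - p) := by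
  have := congrArg (Polynomial.eval p) (bernsteinPolynomial.variance ℝ m)
  simp only [Polynomial.eval_finsetSum, Polynomial.eval_mul, Polynomial.eval_pow,
    Polynomial.eval_sub, Polynomial.eval_X, Polynomial.eval_natCast,
    Polynomial.eval_one, nsmul_eq_mul, ← binW_eq_eval] at this
  rw [← this]
  exact Finset.sum_congr rfl fun k _ => by ring

/-- Chebyshev's inequality for a function vanishing near the mean. -/
lemma sum_binW_mul_le {p : ℝ} (hp0 : 0 ≤ p) (hp1 : p ≤ 1) (m : ℕ) {r : ℝ} (hr : 0 < r)
    (f : ℕ → ℝ) (hf1 : ∀ k, f k ≤ 1) (hf : ∀ k : ℕ, |(m : ℝ) * p - k| < r → f k ≤ 0) :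
    ∑ k ∈ Finset.range (m + 1), binW p m k * f k ≤ m * p * (1 - p) / r ^ 2 := by
  rw [← sum_binW_sq_dev, Finset.sum_div]
  refine Finset.sum_le_sum fun k _ => ?_
  rw [mul_div_assoc]
  refine mul_le_mul_of_nonneg_left ?_ (binW_nonneg hp0 hp1 _ _)
  rcases lt_or_ge |(m : ℝ) * p - k| r with h | h
  · exact (hf k h).trans (by positivity)
  · refine (hf1 k).trans ?_
    rw [le_div_iff₀ (by positivity), one_mul, ← sq_abs ((m : ℝ) * p - k)]
    exact pow_le_pow_left₀ hr.le h 2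

lemma binW_succ_left (p : ℝ) (m k : ℕ) :
    ((k + 1 : ℕ) : ℝ) * binW p (m + 1) (k + 1) = ((m + 1 : ℕ) : ℝ) * p * binW p m k := by
  have h := Nat.add_one_mul_choose_eq m k
  have h' : ((m + 1 : ℕ) : ℝ) * (m.choose k : ℝ) = ((m + 1).choose (k + 1) : ℝ) * ((k + 1 : ℕ) : ℝ) := by
    exact_mod_cast h
  simp only [binW, Nat.add_sub_add_right]
  rw [pow_succ]
  linear_combination (-(p ^ k * p * (1 - p) ^ (m - k))) * h'

lemma binW_succ_right (p : ℝ) (m k : ℕ) (hk : k ≤ m) :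
    (((m + 1 : ℕ) : ℝ) - k) * binW p (m + 1) k = ((m + 1 : ℕ) : ℝ) * (1 - p) * binW p m k := by
  have h := Nat.choose_mul_succ_eq m k
  have h' : (m.choose k : ℝ) * ((m + 1 : ℕ) : ℝ) = ((m + 1).choose k : ℝ) * (((m + 1 : ℕ) : ℝ) - k) := by
    rw [← Nat.cast_sub (by omega)]
    exact_mod_cast h
  simp only [binW, Nat.succ_sub hk]
  rw [pow_succ]
  linear_combination (-(p ^ k * (1 - p) * (1 - p) ^ (m - k))) * h'

lemma sum_binW_diff {p : ℝ} (hp0 : p ≠ 0) (hp1 : 1 - p ≠ 0) (m : ℕ) (a : ℕ → ℝ) :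
    ∑ k ∈ Finset.range (m + 1), binW p m k * (a (k + 1) - a k) =
      ∑ k ∈ Finset.range (m + 2), binW p (m + 1) k *
        (((k : ℝ) - ((m + 1 : ℕ) : ℝ) * p) / (((m + 1 : ℕ) : ℝ) * p * (1 - p)) * a k) := by
  have hm : ((m + 1 : ℕ) : ℝ) ≠ 0 := by positivity
  have e1 : ∑ k ∈ Finset.range (m + 1), binW p m k * a (k + 1) =
      ∑ k ∈ Finset.range (m + 2), (k : ℝ) / (((m + 1 : ℕ) : ℝ) * p) * binW p (m + 1) k * a k := by
    rw [Finset.sum_range_succ' _ (m + 1)]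
    simp only [Nat.cast_zero, zero_div, zero_mul, add_zero]
    refine Finset.sum_congr rfl fun k _ => ?_
    have := binW_succ_left p m k
    field_simp
    linear_combination (-a (k + 1)) * this
  have e2 : ∑ k ∈ Finset.range (m + 1), binW p m k * a k =
      ∑ k ∈ Finset.range (m + 2),
        (((m + 1 : ℕ) : ℝ) - k) / (((m + 1 : ℕ) : ℝ) * (1 - p)) * binW p (m + 1) k * a k := by
    rw [Finset.sum_range_succ _ (m + 1)]
    simp only [sub_self, zero_div, zero_mul, add_zero]
    refine Finset.sum_congr rfl fun k hk => ?_
    have := binW_succ_right p m k (by simpa [Nat.lt_succ_iff] using hk)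
    field_simp
    linear_combination (-a k) * this
  simp only [mul_sub, Finset.sum_sub_distrib]
  rw [e1, e2, ← Finset.sum_sub_distrib]
  refine Finset.sum_congr rfl fun k _ => ?_
  field_simp
  ring_nf

lemma abs_sum_binW_diff_le {p : ℝ} (hp0 : 0 < p) (hp1 : p < 1) (m : ℕ) (a : ℕ → ℝ)
    (ha : ∀ k, |a k| ≤ 1) :
    |∑ k ∈ Finset.range (m + 1), binW p m k * (a (k + 1) - a k)| ≤
      1 / Real.sqrt (((m + 1 : ℕ) : ℝ) * p * (1 - p)) := by
  have hq : 0 < 1 - p := by linarith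
  set v : ℝ := ((m + 1 : ℕ) : ℝ) * p * (1 - p) with hv
  have hvpos : 0 < v := by positivity
  rw [sum_binW_diff hp0.ne' hq.ne']
  refine (Real.abs_le_sqrt (y := 1 / v) ?_).trans_eq ?_
  · have hw : ∀ k, 0 ≤ binW p (m + 1) k := binW_nonneg hp0.le hp1.le _
    have cs := Finset.sum_mul_sq_le_sq_mul_sq (Finset.range (m + 2))
      (fun k => Real.sqrt (binW p (m + 1) k))
      (fun k => Real.sqrt (binW p (m + 1) k) * (((k : ℝ) - ((m + 1 : ℕ) : ℝ) * p) / v * a k))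
    simp only [← mul_assoc, Real.mul_self_sqrt (hw _), Real.sq_sqrt (hw _), mul_pow] at cs
    simp only [← mul_assoc]
    refine cs.trans ?_
    rw [sum_binW, one_mul]
    calc ∑ k ∈ Finset.range (m + 2), binW p (m + 1) k *
            (((k : ℝ) - ((m + 1 : ℕ) : ℝ) * p) / v) ^ 2 * a k ^ 2
        ≤ ∑ k ∈ Finset.range (m + 2),
            binW p (m + 1) k * (((m + 1 : ℕ) : ℝ) * p - k) ^ 2 / v ^ 2 := by
          refine Finset.sum_le_sum fun k _ => ?_
          have : a k ^ 2 ≤ 1 := by rw [sq_le_one_iff_abs_le_one]; exact ha k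
          calc _ ≤ binW p (m + 1) k * (((k : ℝ) - ((m + 1 : ℕ) : ℝ) * p) / v) ^ 2 * 1 :=
                mul_le_mul_of_nonneg_left this (mul_nonneg (hw k) (sq_nonneg _))
            _ = _ := by ring_nf
      _ = 1 / v := by
          rw [← Finset.sum_div, sum_binW_sq_dev, ← hv]
          field_simp
  · rw [Real.sqrt_div zero_le_one, Real.sqrt_one]

/-! ### Birth and death chains killed at the right end -/

/-- A reversible substochastic birth and death matrix which loses mass exactly at the last state. -/
structure SubBD (N : ℕ) where
  Q : Matrix (Fin N) (Fin N) ℝ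
  wt : Fin N → ℝ
  nonneg : ∀ x y, 0 ≤ Q x y
  tridiag : ∀ x y : Fin N, 1 < |(x : ℤ) - (y : ℤ)| → Q x y = 0
  row_eq : ∀ x : Fin N, (x : ℕ) + 1 < N → ∑ y, Q x y = 1
  row_lt : ∀ x : Fin N, (x : ℕ) + 1 = N → ∑ y, Q x y < 1
  up_pos : ∀ x y : Fin N, (y : ℕ) = x + 1 → 0 < Q x y
  wt_pos : ∀ x, 0 < wt x
  rev : ∀ x y, wt x * Q x y = wt y * Q y x
  wt_sum : ∑ x, wt x ≤ 1

namespace SubBD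

variable {N : ℕ} (B : SubBD N)

/-- The survival function: `surv m x` is the probability of not being killed by time `m`. -/
def surv (m : ℕ) : Fin N → ℝ := (B.Q ^ m) *ᵥ 1

lemma row_le (x : Fin N) : ∑ y, B.Q x y ≤ 1 := by
  rcases Nat.lt_or_ge ((x : ℕ) + 1) N with h | h
  · exact (B.row_eq x h).le
  · exact (B.row_lt x (by omega)).le

lemma tridiag_up {x y : Fin N} (h : (x : ℕ) + 1 < y) : B.Q x y = 0 := by
  apply B.tridiag
  rw [abs_sub_comm]
  exact lt_of_lt_of_le (by omega) (le_abs_self _)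

lemma surv_zero (x : Fin N) : B.surv 0 x = 1 := by simp [surv]

lemma surv_succ (m : ℕ) (x : Fin N) : B.surv (m + 1) x = ∑ y, B.Q x y * B.surv m y := by
  simp only [surv, pow_succ', ← Matrix.mulVec_mulVec]
  rfl

lemma surv_add (m k : ℕ) : B.surv (m + k) = (B.Q ^ m) *ᵥ B.surv k := by
  simp only [surv, pow_add, ← Matrix.mulVec_mulVec]

lemma surv_nonneg (m : ℕ) (x : Fin N) : 0 ≤ B.surv m x := by
  induction m generalizing x with
  | zero => simp [surv_zero]
  | succ m ih => rw [surv_succ]; exact Finset.sum_nonneg fun y _ => mul_nonneg (B.nonneg _ _) (ih y)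

lemma surv_le_one (m : ℕ) (x : Fin N) : B.surv m x ≤ 1 := by
  induction m generalizing x with
  | zero => simp [surv_zero]
  | succ m ih =>
    rw [surv_succ]
    refine le_trans ?_ (B.row_le x)
    exact Finset.sum_le_sum fun y _ => mul_le_of_le_one_right (B.nonneg _ _) (ih y)

lemma surv_succ_le (m : ℕ) (x : Fin N) : B.surv (m + 1) x ≤ B.surv m x := by
  induction m generalizing x with
  | zero => rw [surv_zero]; exact B.surv_le_one _ _
  | succ m ih =>
    rw [surv_succ, surv_succ]
    exact Finset.sum_le_sum fun y _ => mul_le_mul_of_nonneg_left (ih y) (B.nonneg _ _)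

lemma surv_antitone (x : Fin N) : Antitone fun m => B.surv m x :=
  antitone_nat_of_succ_le fun m => B.surv_succ_le m x

lemma surv_anti (m : ℕ) : Antitone (B.surv m) := by
  induction m with
  | zero => intro x y _; simp [surv_zero]
  | succ m ih =>
    intro x y hxy
    rcases hxy.eq_or_lt with rfl | hlt
    · exact le_rfl
    have hN : (x : ℕ) + 1 < N := lt_of_le_of_lt hlt y.isLt
    let x' : Fin N := ⟨x + 1, hN⟩
    have hx'y : x' ≤ y := hlt
    refine (B.surv_succ_le m y).trans ((ih hx'y).trans ?_)
    rw [surv_succ, ← one_mul (B.surv m x'), ← B.row_eq x hN, Finset.sum_mul]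
    refine Finset.sum_le_sum fun w _ => ?_
    rcases Nat.lt_or_ge ((x : ℕ) + 1) w with h | h
    · simp [B.tridiag_up h]
    · exact mul_le_mul_of_nonneg_left (ih (show w ≤ x' from h)) (B.nonneg _ _)

lemma pow_nonneg (m : ℕ) (x y : Fin N) : 0 ≤ (B.Q ^ m) x y := by
  induction m generalizing x with
  | zero => simp only [pow_zero, Matrix.one_apply]; split_ifs <;> simp
  | succ m ih =>
    rw [pow_succ', Matrix.mul_apply]
    exact Finset.sum_nonneg fun w _ => mul_nonneg (B.nonneg _ _) (ih w)

lemma surv_eq_sum (m : ℕ) (x : Fin N) : B.surv m x = ∑ y, (B.Q ^ m) x y := by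
  simp [surv, Matrix.mulVec, dotProduct]

lemma abs_pow_mulVec_le (m : ℕ) (v : Fin N → ℝ) {c : ℝ} (hv : ∀ y, |v y| ≤ c) (x : Fin N) :
    |((B.Q ^ m) *ᵥ v) x| ≤ c * B.surv m x := by
  rw [surv_eq_sum, Finset.mul_sum]
  simp only [Matrix.mulVec, dotProduct]
  refine (Finset.abs_sum_le_sum_abs _ _).trans (Finset.sum_le_sum fun y _ => ?_)
  rw [abs_mul, abs_of_nonneg (B.pow_nonneg m x y), mul_comm]
  exact mul_le_mul_of_nonneg_right (hv y) (B.pow_nonneg m x y)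

lemma surv_lt_one (m : ℕ) (x : Fin N) (h : N ≤ m + x) : B.surv m x < 1 := by
  induction m generalizing x with
  | zero => omega
  | succ m ih =>
    rw [surv_succ]
    rcases Nat.lt_or_ge ((x : ℕ) + 1) N with hN | hN
    · rw [← B.row_eq x hN]
      refine Finset.sum_lt_sum (fun y _ => mul_le_of_le_one_right (B.nonneg _ _) (B.surv_le_one _ _))
        ⟨⟨x + 1, hN⟩, Finset.mem_univ _, ?_⟩
      exact mul_lt_of_lt_one_right (B.up_pos _ _ rfl) (ih _ (by simp; omega))
    · refine lt_of_le_of_lt ?_ (B.row_lt x (by omega))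
      exact Finset.sum_le_sum fun y _ => mul_le_of_le_one_right (B.nonneg _ _) (B.surv_le_one _ _)

variable [NeZero N]

lemma surv_le_zero (m : ℕ) (x : Fin N) : B.surv m x ≤ B.surv m 0 := B.surv_anti m (Fin.zero_le x)

lemma surv_add_le (k m : ℕ) (x : Fin N) : B.surv (k + m) x ≤ B.surv m 0 * B.surv k x := by
  rw [surv_add]
  refine (le_abs_self _).trans (B.abs_pow_mulVec_le k _ (fun y => ?_) x)
  rw [abs_of_nonneg (B.surv_nonneg _ _)]
  exact B.surv_le_zero m y

lemma exists_surv_bound : ∃ C θ : ℝ, 0 < C ∧ 0 < θ ∧ θ < 1 ∧ ∀ m x, B.surv m x ≤ C * θ ^ m := by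
  obtain ⟨C, θ, hC, h0, h1, h⟩ := exists_geometric_bound (s := fun m => B.surv m 0) (N := N)
    (fun m => B.surv_nonneg m 0)
    (fun m => B.surv_le_one m 0) (fun k m => B.surv_add_le k m 0)
    (Nat.pos_of_neZero N) (B.surv_lt_one N 0 (by simp))
  exact ⟨C, θ, hC, h0, h1, fun m x => (B.surv_le_zero m x).trans (h m)⟩

lemma surv_summable (x : Fin N) : Summable fun m => B.surv m x := by
  obtain ⟨C, θ, hC, h0, h1, h⟩ := B.exists_surv_bound
  exact Summable.of_nonneg_of_le (fun m => B.surv_nonneg m x) (fun m => h m x)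
    ((summable_geometric_of_lt_one h0.le h1).mul_left C)

lemma surv_summable_two (x : Fin N) : Summable fun m : ℕ => (2 * (m : ℝ) + 1) * B.surv m x := by
  obtain ⟨C, θ, hC, h0, h1, h⟩ := B.exists_surv_bound
  have hg := summable_geometric_of_lt_one h0.le h1
  have hg1 : Summable fun m : ℕ => (m : ℝ) * θ ^ m := by
    have := summable_pow_mul_geometric_of_norm_lt_one (R := ℝ) 1 (r := θ)
      (by rwa [Real.norm_of_nonneg h0.le])
    simpa using this
  refine Summable.of_nonneg_of_le (fun m => mul_nonneg (by positivity) (B.surv_nonneg m x))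
    (fun m => mul_le_mul_of_nonneg_left (h m x) (by positivity))
    (f := fun m : ℕ => (2 * (m : ℝ) + 1) * (C * θ ^ m)) ?_
  refine (((hg1.mul_left (2 * C)).add (hg.mul_left C))).congr fun m => ?_
  ring

lemma surv_tendsto (x : Fin N) : Tendsto (fun m => B.surv m x) atTop (nhds 0) :=
  (B.surv_summable x).tendsto_atTop_zero

/-- The maximum principle. -/
lemma nonneg_of_super (v : Fin N → ℝ) (hv : ∀ x, (B.Q *ᵥ v) x ≤ v x) (x : Fin N) : 0 ≤ v x := by
  have hm : ∀ m x, ((B.Q ^ m) *ᵥ v) x ≤ v x := by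
    intro m
    induction m with
    | zero => simp
    | succ m ih =>
      intro x
      refine le_trans ?_ (hv x)
      rw [pow_succ', ← Matrix.mulVec_mulVec]
      simp only [Matrix.mulVec, dotProduct] at ih ⊢
      exact Finset.sum_le_sum fun y _ => mul_le_mul_of_nonneg_left (ih y) (B.nonneg x y)
  have hb : ∀ y, |v y| ≤ ∑ y, |v y| := fun y =>
    Finset.single_le_sum (f := fun y => |v y|) (fun _ _ => abs_nonneg _) (Finset.mem_univ y)
  have ht : Tendsto (fun m => -((∑ y, |v y|) * B.surv m x)) atTop (nhds 0) := by
    simpa using ((B.surv_tendsto x).const_mul (∑ y, |v y|)).neg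
  exact le_of_tendsto' ht fun m =>
    (neg_le_of_abs_le (B.abs_pow_mulVec_le m v hb x)).trans (hm m x)

end SubBD

namespace SubBD

variable {N : ℕ} (B : SubBD N)

/-- Expected killing time. -/
def mean (x : Fin N) : ℝ := ∑' m, B.surv m x

/-- Second moment of the killing time. -/
def mom2 (x : Fin N) : ℝ := ∑' m : ℕ, (2 * (m : ℝ) + 1) * B.surv m x

/-- The Green function. -/
def green : Matrix (Fin N) (Fin N) ℝ := (1 - B.Q)⁻¹

lemma one_sub_mulVec (v : Fin N → ℝ) (x : Fin N) :
    ((1 - B.Q) *ᵥ v) x = v x - ∑ y, B.Q x y * v y := by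
  rw [Matrix.sub_mulVec, Matrix.one_mulVec]
  rfl

lemma mean_nonneg (x : Fin N) : 0 ≤ B.mean x := tsum_nonneg fun m => B.surv_nonneg m x

variable [NeZero N]

lemma mean_eq (x : Fin N) : B.mean x = 1 + ∑ y, B.Q x y * B.mean y := by
  unfold mean
  rw [(B.surv_summable x).tsum_eq_zero_add, surv_zero]
  congr 1
  simp_rw [surv_succ, ← tsum_mul_left]
  exact Summable.tsum_finsetSum fun y _ => (B.surv_summable y).mul_left _

lemma mom2_eq (x : Fin N) : B.mom2 x = 2 * B.mean x - 1 + ∑ y, B.Q x y * B.mom2 y := by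
  have h1 := B.surv_summable_two
  have h2 := B.surv_summable
  have e : ∀ y, B.mom2 y + 2 * B.mean y = ∑' m : ℕ, (2 * ((m + 1 : ℕ) : ℝ) + 1) * B.surv m y := by
    intro y
    unfold mom2 mean
    rw [← tsum_mul_left, ← (h1 y).tsum_add ((h2 y).mul_left 2)]
    exact tsum_congr fun m => by push_cast; ring
  have hs : ∀ y, Summable fun m : ℕ => (2 * ((m + 1 : ℕ) : ℝ) + 1) * B.surv m y := fun y =>
    ((h1 y).add ((h2 y).mul_left 2)).congr fun m => by push_cast; ring
  have h3 : B.mom2 x = 1 + ∑ y, B.Q x y * (B.mom2 y + 2 * B.mean y) := by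
    simp_rw [e]
    rw [mom2, (h1 x).tsum_eq_zero_add, surv_zero]
    congr 1
    · simp
    simp_rw [surv_succ, ← tsum_mul_left, Finset.mul_sum]
    rw [← Summable.tsum_finsetSum fun y _ => (hs y).mul_left _]
    exact tsum_congr fun m => Finset.sum_congr rfl fun y _ => by ring
  have h4 := B.mean_eq x
  rw [h3]
  simp only [mul_add, Finset.sum_add_distrib]
  rw [show ∑ y, B.Q x y * (2 * B.mean y) = 2 * ∑ y, B.Q x y * B.mean y by
    rw [Finset.mul_sum]; exact Finset.sum_congr rfl fun y _ => by ring]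
  linarith

lemma one_le_mean (x : Fin N) : 1 ≤ B.mean x := by
  rw [mean_eq]
  have := Finset.sum_nonneg fun y (_ : y ∈ Finset.univ) => mul_nonneg (B.nonneg x y) (B.mean_nonneg y)
  linarith

lemma mean_anti : Antitone B.mean := fun x y hxy =>
  (B.surv_summable y).tsum_le_tsum (fun m => B.surv_anti m hxy) (B.surv_summable x)

lemma mean_lt_var {δ : ℝ} (hδ : ∀ x, δ ≤ B.Q x x) (x : Fin N) :
    δ * B.mean x ≤ B.mom2 x - B.mean x ^ 2 := by
  have := B.nonneg_of_super (fun x => B.mom2 x - B.mean x ^ 2 - δ * B.mean x) (fun x => ?_) x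
  · linarith
  have h1 := B.mean_eq x
  have h2 := B.mom2_eq x
  set h := B.mean x
  have key : ∑ y, B.Q x y * (B.mean y - h + 1) ^ 2 =
      ∑ y, B.Q x y * B.mean y ^ 2 + 2 * (1 - h) * (∑ y, B.Q x y * B.mean y) +
        (1 - h) ^ 2 * ∑ y, B.Q x y := by
    simp only [Finset.mul_sum, ← Finset.sum_add_distrib]
    exact Finset.sum_congr rfl fun y _ => by ring
  have h3 : δ ≤ ∑ y, B.Q x y * (B.mean y - h + 1) ^ 2 := by
    refine le_trans ?_ (Finset.single_le_sum (f := fun y => B.Q x y * (B.mean y - h + 1) ^ 2)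
      (fun y _ => mul_nonneg (B.nonneg x y) (sq_nonneg _)) (Finset.mem_univ x))
    simpa [h] using hδ x
  have h4 := B.row_le x
  have h5 : 0 ≤ (1 - h) ^ 2 * (1 - ∑ y, B.Q x y) := mul_nonneg (sq_nonneg _) (by linarith)
  have h6 : (B.Q *ᵥ fun x => B.mom2 x - B.mean x ^ 2 - δ * B.mean x) x =
      ∑ y, B.Q x y * B.mom2 y - ∑ y, B.Q x y * B.mean y ^ 2 - δ * ∑ y, B.Q x y * B.mean y := by
    simp only [Matrix.mulVec, dotProduct, Finset.mul_sum, ← Finset.sum_sub_distrib]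
    exact Finset.sum_congr rfl fun y _ => by ring
  rw [h6]
  have h7 : ∑ y, B.Q x y * B.mean y = h - 1 := by linarith
  rw [h7] at key ⊢
  rw [key] at h3
  nlinarith

lemma isUnit_one_sub : IsUnit (1 - B.Q) := by
  rw [← Matrix.mulVec_injective_iff_isUnit]
  intro v w hvw
  have h0 : ∀ x, (v - w) x - ∑ y, B.Q x y * (v - w) y = 0 := fun x => by
    rw [← one_sub_mulVec, Matrix.mulVec_sub, sub_eq_zero.mpr hvw]; rfl
  funext x
  have h1 := B.nonneg_of_super (v - w) (fun x => by
    have := h0 x; simp only [Matrix.mulVec, dotProduct]; linarith) x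
  have h2 := B.nonneg_of_super (-(v - w)) (fun x => by
    have := h0 x; rw [Matrix.mulVec_neg]; simp only [Matrix.mulVec, dotProduct, Pi.neg_apply]
    linarith) x
  simp only [Pi.sub_apply, Pi.neg_apply] at h1 h2
  linarith

lemma one_sub_mul_green : (1 - B.Q) * B.green = 1 :=
  Matrix.mul_nonsing_inv _ ((Matrix.isUnit_iff_isUnit_det _).mp B.isUnit_one_sub)

lemma green_mul_one_sub : B.green * (1 - B.Q) = 1 :=
  Matrix.nonsing_inv_mul _ ((Matrix.isUnit_iff_isUnit_det _).mp B.isUnit_one_sub)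

lemma green_mulVec_of {v f : Fin N → ℝ} (h : ∀ x, v x - ∑ y, B.Q x y * v y = f x) :
    B.green *ᵥ f = v := by
  have : f = (1 - B.Q) *ᵥ v := by funext x; rw [one_sub_mulVec, h]
  rw [this, Matrix.mulVec_mulVec, green_mul_one_sub, Matrix.one_mulVec]

lemma green_eq (x y : Fin N) :
    B.green x y - ∑ w, B.Q x w * B.green w y = if x = y then 1 else 0 := by
  have := congrFun (congrFun B.one_sub_mul_green x) y
  rw [Matrix.sub_mul, Matrix.one_mul, Matrix.sub_apply, Matrix.mul_apply, Matrix.one_apply] at this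
  exact this

lemma green_of_le {x y : Fin N} (hxy : x ≤ y) : B.green x y = B.green y y := by
  have key : ∀ k : ℕ, ∀ hk : k ≤ y, ∀ w : Fin N, (w : ℕ) ≤ k →
      B.green w y = B.green ⟨k, by omega⟩ y := by
    intro k
    induction k with
    | zero =>
      intro hk w hw
      congr 1
      exact Fin.ext (by simpa using hw)
    | succ k ih =>
      intro hk w hw
      have hkN : k < N := by omega
      set a : Fin N := ⟨k, hkN⟩ with ha
      set b : Fin N := ⟨k + 1, by omega⟩ with hb
      have hab : B.green b y = B.green a y := by
        have h1 := B.green_eq a y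
        rw [if_neg (by rintro rfl; simp [ha] at hk)] at h1
        have h2 := B.row_eq a (by simp [ha]; omega)
        have h3 : ∑ w, B.Q a w * (B.green w y - B.green a y) = 0 := by
          simp only [mul_sub, Finset.sum_sub_distrib, ← Finset.sum_mul, h2]
          linarith
        rw [Finset.sum_eq_single b] at h3
        · rcases mul_eq_zero.mp h3 with h | h
          · exact absurd h (B.up_pos a b rfl).ne'
          · linarith
        · intro w _ hw
          rcases Nat.lt_or_ge k w with h | h
          · rw [B.tridiag_up, zero_mul]
            have : (w : ℕ) ≠ k + 1 := fun h => hw (Fin.ext h)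
            simp only [ha]; omega
          · rw [ih (by omega) w h, sub_self, mul_zero]
        · simp
      rcases Nat.lt_or_ge k w with h | h
      · congr 1
        exact Fin.ext (by simp [hb]; omega)
      · rw [hab]; exact ih (by omega) w h
  exact key y le_rfl x hxy

lemma mean_eq_green (x : Fin N) : B.mean x = ∑ y, B.green x y := by
  have := B.green_mulVec_of (v := B.mean) (f := fun _ => 1) (fun x => by
    have := B.mean_eq x; linarith)
  rw [← this]; simp [Matrix.mulVec, dotProduct]

lemma mean_zero_eq_trace : B.mean 0 = ∑ y, B.green y y := by
  rw [mean_eq_green]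
  exact Finset.sum_congr rfl fun y _ => B.green_of_le (Fin.zero_le y)

lemma mom2_zero : B.mom2 0 - B.mean 0 ^ 2 + B.mean 0 = ∑ x, ∑ y, B.green x y * B.green y x := by
  have h := B.green_mulVec_of (v := B.mom2) (f := fun x => 2 * B.mean x - 1) (fun x => by
    have := B.mom2_eq x; linarith)
  have h1 : B.mom2 0 = ∑ x, B.green 0 x * (2 * B.mean x - 1) := by rw [← h]; rfl
  have h2 : B.mom2 0 = 2 * (∑ x, ∑ y, B.green x x * B.green x y) - B.mean 0 := by
    rw [h1, B.mean_eq_green 0, Finset.mul_sum, ← Finset.sum_sub_distrib]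
    refine Finset.sum_congr rfl fun x _ => ?_
    rw [B.mean_eq_green x, ← Finset.mul_sum, B.green_of_le (Fin.zero_le x)]
    ring
  have h3 : (∑ x, ∑ y, B.green x x * B.green x y) + (∑ x, ∑ y, B.green x x * B.green x y) =
      B.mean 0 ^ 2 + ∑ x, ∑ y, B.green x y * B.green y x := by
    have hsw : ∑ x, ∑ y, B.green x x * B.green x y = ∑ x, ∑ y, B.green y y * B.green y x :=
      Finset.sum_comm
    nth_rewrite 2 [hsw]
    rw [B.mean_zero_eq_trace, sq, Finset.sum_mul_sum]
    simp only [← Finset.sum_add_distrib]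
    refine Finset.sum_congr rfl fun x _ => Finset.sum_congr rfl fun y _ => ?_
    rcases le_total x y with hxy | hxy
    · rw [B.green_of_le hxy]
    · rw [B.green_of_le hxy]; ring
  linarith

end SubBD

namespace SubBD

variable {N : ℕ} (B : SubBD N)

lemma pow_mulVec_eig {v : Fin N → ℝ} {κ : ℝ} (h : B.Q *ᵥ v = κ • v) (m : ℕ) :
    (B.Q ^ m) *ᵥ v = κ ^ m • v := by
  induction m with
  | zero => simp
  | succ m ih =>
    rw [pow_succ, ← Matrix.mulVec_mulVec, h, Matrix.mulVec_smul, ih, smul_smul, pow_succ']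

lemma mulVec_of_eig {v : Fin N → ℝ} {l : ℝ} (h : (1 - B.Q) *ᵥ v = l • v) :
    B.Q *ᵥ v = (1 - l) • v := by
  rw [Matrix.sub_mulVec, Matrix.one_mulVec] at h
  rw [sub_smul, one_smul, ← h, sub_sub_cancel]

/-- The Dirichlet form bound by the smallest eigenvalue. -/
lemma rayleigh {l : ℝ} (hl : ∀ x ∈ eigSet (1 - B.Q), l ≤ x) (v : Fin N → ℝ) :
    l * ∑ x, B.wt x * v x ^ 2 ≤ ∑ x, B.wt x * v x * (v x - ∑ y, B.Q x y * v y) := by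
  classical
  set r : Fin N → ℝ := fun x => Real.sqrt (B.wt x) with hr
  have hr0 : ∀ x, 0 < r x := fun x => Real.sqrt_pos.mpr (B.wt_pos x)
  have hr2 : ∀ x, r x * r x = B.wt x := fun x => Real.mul_self_sqrt (B.wt_pos x).le
  set A : Matrix (Fin N) (Fin N) ℝ := Matrix.of fun x y => r x * (1 - B.Q) x y / r y with hA
  have hAl : (A - l • 1).IsHermitian := by
    refine Matrix.IsHermitian.sub (Matrix.IsHermitian.ext fun x y => ?_) ?_
    · simp only [hA, Matrix.of_apply, star_trivial, Matrix.sub_apply, Matrix.one_apply]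
      rw [div_eq_div_iff (hr0 x).ne' (hr0 y).ne']
      have h1 := B.rev x y
      rw [← hr2, ← hr2] at h1
      by_cases hxy : x = y
      · subst hxy; rfl
      · rw [if_neg hxy, if_neg (Ne.symm hxy)]; linarith
    · refine Matrix.IsHermitian.ext fun x y => ?_
      simp [Matrix.one_apply, eq_comm]
  have hAmul : ∀ g : Fin N → ℝ, A *ᵥ g = fun x => r x * ((1 - B.Q) *ᵥ fun y => g y / r y) x := by
    intro g
    funext x
    simp only [hA, Matrix.mulVec, dotProduct, Matrix.of_apply, Finset.mul_sum]
    exact Finset.sum_congr rfl fun y _ => by ring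
  have hpsd : (A - l • 1).PosSemidef := by
    rw [hAl.posSemidef_iff_eigenvalues_nonneg]
    intro i
    have h1 := hAl.mulVec_eigenvectorBasis i
    set g : Fin N → ℝ := ⇑(hAl.eigenvectorBasis i) with hg
    set μ := hAl.eigenvalues i
    have hg0 : g ≠ 0 := by
      intro h0
      have := hAl.eigenvectorBasis.orthonormal.ne_zero i
      exact this (by ext j; exact congrFun h0 j)
    have h2 : A *ᵥ g = (μ + l) • g := by
      rw [Matrix.sub_mulVec, Matrix.smul_mulVec, Matrix.one_mulVec] at h1
      rw [add_smul, ← h1, sub_add_cancel]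
    have h3 := hl (μ + l) ⟨fun y => g y / r y, fun h0 => hg0 (funext fun y => by
        have := congrFun h0 y
        simpa [(hr0 y).ne'] using this), by
      funext x
      have h4 := congrFun h2 x
      rw [hAmul] at h4
      simp only [Pi.smul_apply, smul_eq_mul] at h4 ⊢
      rw [← mul_div_assoc, eq_div_iff (hr0 x).ne', mul_comm]
      exact h4⟩
    show 0 ≤ μ
    linarith
  have h5 := hpsd.dotProduct_mulVec_nonneg (fun x => r x * v x)
  rw [Matrix.sub_mulVec, hAmul, Matrix.smul_mulVec, Matrix.one_mulVec] at h5
  simp only [dotProduct, Pi.sub_apply, Pi.smul_apply, smul_eq_mul, Pi.star_apply, star_trivial,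
    mul_div_cancel_left₀ _ (hr0 _).ne', one_sub_mulVec, mul_sub, Finset.sum_sub_distrib] at h5
  have e1 : ∑ x, r x * v x * (l * (r x * v x)) = l * ∑ x, B.wt x * v x ^ 2 := by
    rw [Finset.mul_sum]
    exact Finset.sum_congr rfl fun x _ => by rw [← hr2]; ring
  have e2 : ∑ x, r x * v x * (r x * v x) = ∑ x, B.wt x * v x * v x :=
    Finset.sum_congr rfl fun x _ => by rw [← hr2]; ring
  have e3 : ∑ x, r x * v x * (r x * ∑ y, B.Q x y * v y) =
      ∑ x, B.wt x * v x * ∑ y, B.Q x y * v y :=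
    Finset.sum_congr rfl fun x _ => by rw [← hr2]; ring
  rw [e1, e2, e3] at h5
  simp only [mul_sub, Finset.sum_sub_distrib]
  linarith

variable [NeZero N]

lemma abs_eig_lt {l : ℝ} (hl : l ∈ eigSet (1 - B.Q)) : |1 - l| < 1 := by
  obtain ⟨v, hv0, hv⟩ := hl
  obtain ⟨x, hx⟩ := Function.ne_iff.mp hv0
  by_contra! hcon
  have hb : ∀ y, |v y| ≤ ∑ y, |v y| := fun y =>
    Finset.single_le_sum (f := fun y => |v y|) (fun _ _ => abs_nonneg _) (Finset.mem_univ y)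
  have ht : Tendsto (fun m => (∑ y, |v y|) * B.surv m x) atTop (nhds 0) := by
    simpa using (B.surv_tendsto x).const_mul (∑ y, |v y|)
  have : |v x| ≤ 0 := ge_of_tendsto' ht fun m => by
    refine le_trans ?_ (B.abs_pow_mulVec_le m v hb x)
    rw [B.pow_mulVec_eig (B.mulVec_of_eig hv), Pi.smul_apply, smul_eq_mul, abs_mul, abs_pow]
    exact le_mul_of_one_le_left (abs_nonneg _) (one_le_pow₀ hcon)
  exact hx (abs_nonpos_iff.mp this)

lemma wt_green (x y : Fin N) : B.wt x * B.green x y = B.wt y * B.green y x := by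
  set W : Matrix (Fin N) (Fin N) ℝ := Matrix.diagonal B.wt with hW
  have h1 : W * (1 - B.Q) = (1 - B.Q)ᵀ * W := by
    ext x y
    rw [hW, Matrix.diagonal_mul, Matrix.mul_diagonal, Matrix.transpose_apply, Matrix.sub_apply,
      Matrix.sub_apply, Matrix.one_apply, Matrix.one_apply]
    have := B.rev x y
    by_cases hxy : x = y
    · subst hxy; ring
    · rw [if_neg hxy, if_neg (Ne.symm hxy)]; linarith
  have h2 : B.greenᵀ * (1 - B.Q)ᵀ = 1 := by
    rw [← Matrix.transpose_mul, B.one_sub_mul_green, Matrix.transpose_one]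
  have h3 : W * B.green = B.greenᵀ * W := by
    calc W * B.green = B.greenᵀ * (1 - B.Q)ᵀ * (W * B.green) := by rw [h2, one_mul]
      _ = B.greenᵀ * ((1 - B.Q)ᵀ * W) * B.green := by simp only [Matrix.mul_assoc]
      _ = B.greenᵀ * W * ((1 - B.Q) * B.green) := by rw [← h1]; simp only [Matrix.mul_assoc]
      _ = B.greenᵀ * W := by rw [B.one_sub_mul_green, mul_one]
  have := congrFun (congrFun h3 x) y
  rw [hW, Matrix.diagonal_mul, Matrix.mul_diagonal, Matrix.transpose_apply] at this
  linarith

lemma eig_pos {l : ℝ} (hl : IsSmallestEig (1 - B.Q) l) : 0 < l := by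
  have := (abs_lt.mp (B.abs_eig_lt hl.1)).2; linarith

lemma eig_lt_two {l : ℝ} (hl : IsSmallestEig (1 - B.Q) l) : l < 2 := by
  have := (abs_lt.mp (B.abs_eig_lt hl.1)).1; linarith

lemma var_add_mean_le {l : ℝ} (hl : IsSmallestEig (1 - B.Q) l) :
    B.mom2 0 - B.mean 0 ^ 2 + B.mean 0 ≤ B.mean 0 / l := by
  have hl0 := B.eig_pos hl
  rw [le_div_iff₀ hl0, mom2_zero, Finset.sum_comm, Finset.sum_mul]
  rw [mean_zero_eq_trace]
  refine Finset.sum_le_sum fun y _ => ?_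
  have h1 := B.rayleigh hl.2 (fun x => B.green x y)
  simp only [B.green_eq] at h1
  have h2 : ∑ x, B.wt x * B.green x y * (if x = y then (1:ℝ) else 0) = B.wt y * B.green y y := by
    simp
  rw [h2] at h1
  have h3 : ∑ x, B.wt x * B.green x y ^ 2 = B.wt y * ∑ x, B.green x y * B.green y x := by
    rw [Finset.mul_sum]
    refine Finset.sum_congr rfl fun x _ => ?_
    have := B.wt_green x y
    rw [sq, ← mul_assoc, this]; ring
  rw [h3] at h1
  have := B.wt_pos y
  rw [← mul_le_mul_iff_right₀ this]
  linarith

lemma inv_eig_sq_le {l : ℝ} (hl : IsSmallestEig (1 - B.Q) l) :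
    1 / l ^ 2 ≤ B.mom2 0 - B.mean 0 ^ 2 + B.mean 0 := by
  have hl0 := B.eig_pos hl
  obtain ⟨v, hv0, hv⟩ := hl.1
  rw [mom2_zero]
  have hG : ∀ x, v x = l * ∑ y, B.green x y * v y := by
    intro x
    have h1 := congrArg (fun f => (B.green *ᵥ f) x) hv
    simp only [Matrix.mulVec_mulVec, green_mul_one_sub, Matrix.one_mulVec, Matrix.mulVec_smul,
      Pi.smul_apply, smul_eq_mul] at h1
    exact h1
  have hpos : 0 < ∑ x, B.wt x * v x ^ 2 := by
    obtain ⟨x, hx⟩ := Function.ne_iff.mp hv0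
    exact Finset.sum_pos' (fun x _ => mul_nonneg (B.wt_pos x).le (sq_nonneg _))
      ⟨x, Finset.mem_univ _, mul_pos (B.wt_pos x) (by
        have : v x ≠ 0 := hx
        positivity)⟩
  have hcs : ∀ x, (∑ y, B.green x y * v y) ^ 2 ≤
      (∑ y, B.green x y ^ 2 / B.wt y) * ∑ y, B.wt y * v y ^ 2 := by
    intro x
    have := Finset.sum_mul_sq_le_sq_mul_sq Finset.univ
      (fun y => B.green x y / Real.sqrt (B.wt y)) (fun y => Real.sqrt (B.wt y) * v y)
    simp only [div_pow, mul_pow, Real.sq_sqrt (B.wt_pos _).le] at this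
    have e : ∀ y, B.green x y * v y =
        B.green x y / Real.sqrt (B.wt y) * (Real.sqrt (B.wt y) * v y) := fun y => by
      have := (Real.sqrt_pos.mpr (B.wt_pos y)).ne'
      field_simp
    simp only [e]
    exact this
  have h1 : ∑ x, B.wt x * v x ^ 2 ≤
      l ^ 2 * ((∑ x, ∑ y, B.green x y * B.green y x) * ∑ x, B.wt x * v x ^ 2) := by
    calc (∑ x, B.wt x * v x ^ 2 : ℝ) = ∑ x, l ^ 2 * (B.wt x * (∑ y, B.green x y * v y) ^ 2) := by
          refine Finset.sum_congr rfl fun x _ => ?_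
          conv_lhs => rw [hG x]
          ring
      _ ≤ ∑ x, l ^ 2 * (B.wt x * ((∑ y, B.green x y ^ 2 / B.wt y) * ∑ y, B.wt y * v y ^ 2)) := by
          exact Finset.sum_le_sum fun x _ => mul_le_mul_of_nonneg_left
            (mul_le_mul_of_nonneg_left (hcs x) (B.wt_pos x).le) (sq_nonneg _)
      _ = l ^ 2 * ((∑ x, ∑ y, B.green x y * B.green y x) * ∑ x, B.wt x * v x ^ 2) := by
          rw [← Finset.mul_sum, Finset.sum_mul]
          congr 1
          refine Finset.sum_congr rfl fun x _ => ?_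
          rw [← mul_assoc, Finset.mul_sum _ _ (B.wt x)]
          refine congrArg₂ HMul.hMul (Finset.sum_congr rfl fun y _ => ?_) rfl
          have := B.wt_green x y
          have hy := (B.wt_pos y).ne'
          rw [mul_div_assoc', div_eq_iff hy, sq, ← mul_assoc, this]
          ring
  rw [div_le_iff₀ (by positivity)]
  nlinarith

lemma mean_mul_wt_le {l : ℝ} (hl : IsSmallestEig (1 - B.Q) l) (x : Fin N) :
    B.mean x * ∑ y with y ≤ x, B.wt y ≤ 1 / l := by
  have hl0 := B.eig_pos hl
  have h1 := B.rayleigh hl.2 B.mean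
  have h2 : ∀ x, B.mean x - ∑ y, B.Q x y * B.mean y = 1 := fun x => by
    have := B.mean_eq x; linarith
  simp only [h2, mul_one] at h1
  set T := ∑ x, B.wt x * B.mean x with hT
  have h3 : B.mean x * ∑ y with y ≤ x, B.wt y ≤ T := by
    rw [Finset.mul_sum]
    calc ∑ y with y ≤ x, B.mean x * B.wt y ≤ ∑ y with y ≤ x, B.wt y * B.mean y := by
          refine Finset.sum_le_sum fun y hy => ?_
          rw [mul_comm]
          exact mul_le_mul_of_nonneg_left (B.mean_anti (Finset.mem_filter.mp hy).2) (B.wt_pos y).le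
      _ ≤ T := Finset.sum_le_sum_of_subset_of_nonneg (Finset.filter_subset _ _)
          fun y _ _ => mul_nonneg (B.wt_pos y).le (B.mean_nonneg y)
  refine h3.trans ?_
  have h4 : T ^ 2 ≤ (∑ x, B.wt x) * ∑ x, B.wt x * B.mean x ^ 2 := by
    have := Finset.sum_mul_sq_le_sq_mul_sq Finset.univ
      (fun y => Real.sqrt (B.wt y)) (fun y => Real.sqrt (B.wt y) * B.mean y)
    simpa only [← mul_assoc, Real.mul_self_sqrt (B.wt_pos _).le, mul_pow,
      Real.sq_sqrt (B.wt_pos _).le] using this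
  have h5 := B.wt_sum
  have h6 : 0 ≤ ∑ x, B.wt x * B.mean x ^ 2 :=
    Finset.sum_nonneg fun y _ => mul_nonneg (B.wt_pos y).le (sq_nonneg _)
  have h7 : T ^ 2 ≤ ∑ x, B.wt x * B.mean x ^ 2 := h4.trans (mul_le_of_le_one_left h6 h5)
  have h8 : 0 ≤ T := Finset.sum_nonneg fun y _ => mul_nonneg (B.wt_pos y).le (B.mean_nonneg y)
  rw [le_div_iff₀ hl0]
  by_contra! hcon
  have h9 : 0 < T := by
    rcases h8.eq_or_lt with h | h
    · rw [← h] at hcon; linarith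
    · exact h
  have : l * T ^ 2 ≤ T := (mul_le_mul_of_nonneg_left h7 hl0.le).trans h1
  nlinarith

end SubBD

/-- Powers of a lazy version of a matrix are binomial averages of powers of the matrix. -/
lemma lazy_pow_mulVec {ι : Type*} [Fintype ι] [DecidableEq ι] (P : Matrix ι ι ℝ) (p : ℝ) (m : ℕ)
    (v : ι → ℝ) (x : ι) :
    (((p • P + (1 - p) • (1 : Matrix ι ι ℝ)) ^ m) *ᵥ v) x =
      ∑ k ∈ Finset.range (m + 1), binW p m k * ((P ^ k) *ᵥ v) x := by
  have hc : Commute (p • P) ((1 - p) • (1 : Matrix ι ι ℝ)) :=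
    (Commute.one_right _).smul_right _
  rw [hc.add_pow, Matrix.sum_mulVec, Finset.sum_apply]
  refine Finset.sum_congr rfl fun k _ => ?_
  rw [_root_.smul_pow, _root_.smul_pow, one_pow, ← Matrix.mulVec_mulVec, ← Matrix.mulVec_mulVec]
  have : ((m.choose k : ℕ) : Matrix ι ι ℝ) *ᵥ v = (m.choose k : ℝ) • v := by
    rw [← Matrix.diagonal_natCast']
    funext x
    simp [Matrix.mulVec_diagonal]
  rw [this, Matrix.smul_mulVec, Matrix.smul_mulVec, Matrix.one_mulVec, Matrix.mulVec_smul,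
    Matrix.mulVec_smul]
  simp only [Pi.smul_apply, smul_eq_mul, binW]
  ring

/-- A log-concave sequence which decays at most like `κ ^ j` has ratios at least `κ`. -/
lemma ratio_le_of_logConcave {L : ℕ → ℝ} {c κ : ℝ} (hc : 0 < c) (hκ : 0 < κ)
    (hL : ∀ j, c * κ ^ j ≤ L j) (hlc : ∀ j, L (j + 2) * L j ≤ L (j + 1) ^ 2) (j : ℕ) :
    κ * L j ≤ L (j + 1) := by
  have hpos : ∀ j, 0 < L j := fun j => lt_of_lt_of_le (by positivity) (hL j)
  by_contra! hcon
  set ρ := L (j + 1) / L j with hρ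
  have hρ0 : 0 < ρ := div_pos (hpos _) (hpos _)
  have hρκ : ρ < κ := by rwa [hρ, div_lt_iff₀ (hpos j)]
  have hr : ∀ i, L (j + i + 1) ≤ ρ * L (j + i) := by
    intro i
    induction i with
    | zero => rw [hρ, add_zero, div_mul_cancel₀ _ (hpos j).ne']
    | succ i ih =>
      have h1 := hlc (j + i)
      have h2 := hpos (j + i)
      have h3 := hpos (j + i + 1)
      have h4 : L (j + i + 2) * L (j + i) ≤ ρ * L (j + i + 1) * L (j + i) := by nlinarith
      exact le_of_mul_le_mul_right h4 h2
  have hr2 : ∀ i, L (j + i) ≤ ρ ^ i * L j := by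
    intro i
    induction i with
    | zero => simp
    | succ i ih =>
      refine (hr i).trans ?_
      rw [pow_succ']
      nlinarith
  have ht : Tendsto (fun i : ℕ => (ρ / κ) ^ i * L j) atTop (nhds 0) := by
    simpa using (tendsto_pow_atTop_nhds_zero_of_lt_one (r := ρ / κ) (by positivity)
      ((div_lt_one hκ).mpr hρκ)).mul_const (L j)
  have : c * κ ^ j ≤ 0 := ge_of_tendsto' ht fun i => by
    have h1 := (hL (j + i)).trans (hr2 i)
    rw [div_pow, div_mul_eq_mul_div, le_div_iff₀ (by positivity), mul_assoc, ← pow_add]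
    exact h1
  have : 0 < c * κ ^ j := by positivity
  linarith

namespace SubBD

variable {N : ℕ} (B : SubBD N)

/-- The killed chain made lazy. -/
def lazy : SubBD N where
  Q := (1 / 2 : ℝ) • B.Q + (1 - 1 / 2 : ℝ) • (1 : Matrix (Fin N) (Fin N) ℝ)
  wt := B.wt
  nonneg x y := by
    have := B.nonneg x y
    simp only [Matrix.add_apply, Matrix.smul_apply, Matrix.one_apply, smul_eq_mul]
    split_ifs <;> linarith
  tridiag x y h := by
    have : x ≠ y := by rintro rfl; simp at h
    simp [B.tridiag x y h, this]
  row_eq x h := by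
    have := B.row_eq x h
    simp only [Matrix.add_apply, Matrix.smul_apply, Matrix.one_apply, smul_eq_mul,
      Finset.sum_add_distrib, ← Finset.mul_sum, this]
    simp
  row_lt x h := by
    have := B.row_lt x h
    simp only [Matrix.add_apply, Matrix.smul_apply, Matrix.one_apply, smul_eq_mul,
      Finset.sum_add_distrib, ← Finset.mul_sum]
    simp
    linarith
  up_pos x y h := by
    have hxy : x ≠ y := by rintro rfl; omega
    have := B.up_pos x y h
    simp [hxy, this]
  wt_pos := B.wt_pos
  rev x y := by
    have := B.rev x y
    by_cases hxy : x = y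
    · subst hxy; rfl
    · simp only [Matrix.add_apply, Matrix.smul_apply, Matrix.one_apply_ne hxy,
        Matrix.one_apply_ne (Ne.symm hxy), smul_eq_mul]
      linarith
  wt_sum := B.wt_sum

lemma lazy_apply (x y : Fin N) : B.lazy.Q x y = (B.Q x y + if x = y then 1 else 0) / 2 := by
  simp only [lazy, Matrix.add_apply, Matrix.smul_apply, Matrix.one_apply, smul_eq_mul]
  ring

lemma lazy_surv (m : ℕ) (x : Fin N) :
    B.lazy.surv m x = ∑ k ∈ Finset.range (m + 1), binW (1 / 2) m k * B.surv k x :=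
  lazy_pow_mulVec _ _ _ _ _

lemma le_one (x y : Fin N) : B.Q x y ≤ 1 :=
  (Finset.single_le_sum (f := fun y => B.Q x y) (fun y _ => B.nonneg x y)
    (Finset.mem_univ y)).trans (B.row_le x)

lemma tridiag_down {x y : Fin N} (h : (y : ℕ) + 1 < x) : B.Q x y = 0 := by
  apply B.tridiag
  exact lt_of_lt_of_le (by omega) (le_abs_self _)

lemma lazy_minor {x y a b : Fin N} (hxy : x < y) (hab : a < b) :
    B.lazy.Q x b * B.lazy.Q y a ≤ B.lazy.Q x a * B.lazy.Q y b := by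
  have h0 : 0 ≤ B.lazy.Q x a * B.lazy.Q y b := mul_nonneg (B.lazy.nonneg _ _) (B.lazy.nonneg _ _)
  rcases Nat.lt_or_ge ((x : ℕ) + 1) b with h | h
  · rw [B.lazy.tridiag_up h, zero_mul]; exact h0
  rcases Nat.lt_or_ge ((a : ℕ) + 1) y with h' | h'
  · rw [B.lazy.tridiag_down h', mul_zero]; exact h0
  have hxy' : (x : ℕ) < y := hxy
  have hab' : (a : ℕ) < b := hab
  obtain rfl : a = x := Fin.ext (by omega)
  obtain rfl : b = y := Fin.ext (by omega)
  simp only [lazy_apply, if_neg hxy.ne, if_neg hxy.ne', if_true]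
  have := B.nonneg a a; have := B.nonneg b b; have := B.nonneg a b; have := B.nonneg b a
  have := B.le_one a b; have := B.le_one b a
  nlinarith

lemma lazy_surv_cross (j : ℕ) {x y : Fin N} (hxy : x ≤ y) :
    B.lazy.surv (j + 1) y * B.lazy.surv j x ≤ B.lazy.surv (j + 1) x * B.lazy.surv j y := by
  induction j generalizing x y with
  | zero => simpa [surv_zero] using B.lazy.surv_anti 1 hxy
  | succ j ih =>
    rcases hxy.eq_or_lt with rfl | hlt
    · exact le_rfl
    set L := B.lazy.surv
    set P := B.lazy.Q with hP
    have e : ∀ x y, L (j + 1 + 1) x * L (j + 1) y =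
        ∑ a, ∑ b, P x a * P y b * (L (j + 1) a * L j b) := by
      intro x y
      simp only [L, P]
      rw [surv_succ, B.lazy.surv_succ j y, Finset.sum_mul_sum]
      exact Finset.sum_congr rfl fun a _ => Finset.sum_congr rfl fun b _ => by ring
    have e1 : L (j + 1 + 1) x * L (j + 1) y - L (j + 1 + 1) y * L (j + 1) x =
        ∑ a, ∑ b, (P x a * P y b - P y a * P x b) * (L (j + 1) a * L j b) := by
      rw [e, e]
      simp only [← Finset.sum_sub_distrib, sub_mul]
    have e2 : ∑ a, ∑ b, (P x a * P y b - P y a * P x b) * (L (j + 1) a * L j b) =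
        ∑ a, ∑ b, (P x b * P y a - P y b * P x a) * (L (j + 1) b * L j a) := Finset.sum_comm
    have e3 : 0 ≤ (∑ a, ∑ b, (P x a * P y b - P y a * P x b) * (L (j + 1) a * L j b)) +
        ∑ a, ∑ b, (P x b * P y a - P y b * P x a) * (L (j + 1) b * L j a) := by
      simp only [← Finset.sum_add_distrib]
      refine Finset.sum_nonneg fun a _ => Finset.sum_nonneg fun b _ => ?_
      have : (P x a * P y b - P y a * P x b) * (L (j + 1) a * L j b) +
          (P x b * P y a - P y b * P x a) * (L (j + 1) b * L j a) =
          (P x a * P y b - P x b * P y a) * (L (j + 1) a * L j b - L (j + 1) b * L j a) := by ring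
      rw [this]
      rcases lt_trichotomy a b with h | h | h
      · exact mul_nonneg (sub_nonneg.mpr (B.lazy_minor hlt h)) (sub_nonneg.mpr (ih h.le))
      · subst h; simp
      · exact mul_nonneg_of_nonpos_of_nonpos (sub_nonpos.mpr (B.lazy_minor hlt h))
          (sub_nonpos.mpr (ih h.le))
    linarith

variable [NeZero N]

lemma lazy_surv_logConcave (j : ℕ) :
    B.lazy.surv (j + 2) 0 * B.lazy.surv j 0 ≤ B.lazy.surv (j + 1) 0 ^ 2 := by
  have e : B.lazy.surv (j + 1) 0 ^ 2 = B.lazy.surv (j + 1) 0 * ∑ y, B.lazy.Q 0 y * B.lazy.surv j y := by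
    rw [sq, ← B.lazy.surv_succ j 0]
  rw [e, surv_succ, Finset.sum_mul, Finset.mul_sum]
  refine Finset.sum_le_sum fun y _ => ?_
  have := mul_le_mul_of_nonneg_left (B.lazy_surv_cross j (Fin.zero_le y)) (B.lazy.nonneg 0 y)
  linarith

lemma lazy_surv_ratio {l : ℝ} (hl : IsSmallestEig (1 - B.Q) l) (j : ℕ) :
    (1 - l / 2) * B.lazy.surv j 0 ≤ B.lazy.surv (j + 1) 0 := by
  have hl2 := B.eig_lt_two hl
  obtain ⟨v, hv0, hv⟩ := hl.1
  obtain ⟨x, hx⟩ := Function.ne_iff.mp hv0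
  have hb : ∀ y, |v y| ≤ ∑ y, |v y| := fun y =>
    Finset.single_le_sum (f := fun y => |v y|) (fun _ _ => abs_nonneg _) (Finset.mem_univ y)
  have hxp : 0 < |v x| := abs_pos.mpr hx
  have hs : 0 < ∑ y, |v y| := hxp.trans_le (hb x)
  have he : B.lazy.Q *ᵥ v = (1 - l / 2) • v := by
    simp only [lazy, Matrix.add_mulVec, Matrix.smul_mulVec, Matrix.one_mulVec, B.mulVec_of_eig hv,
      smul_smul, ← add_smul]
    congr 1; ring
  have hκ : 0 < 1 - l / 2 := by linarith
  refine ratio_le_of_logConcave (L := fun j => B.lazy.surv j 0) (div_pos hxp hs) hκ (fun j => ?_)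
    B.lazy_surv_logConcave j
  have h1 := B.lazy.abs_pow_mulVec_le j v hb x
  rw [B.lazy.pow_mulVec_eig he, Pi.smul_apply, smul_eq_mul, abs_mul, abs_pow, abs_of_pos hκ] at h1
  have h2 := h1.trans (mul_le_mul_of_nonneg_left (B.lazy.surv_le_zero j x) hs.le)
  rw [div_mul_eq_mul_div, div_le_iff₀ hs]
  linarith

lemma lazy_surv_pow {l : ℝ} (hl : IsSmallestEig (1 - B.Q) l) (j i : ℕ) :
    (1 - l / 2) ^ i * B.lazy.surv j 0 ≤ B.lazy.surv (j + i) 0 := by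
  have hl2 := B.eig_lt_two hl
  induction i with
  | zero => simp
  | succ i ih =>
    rw [pow_succ', mul_assoc]
    exact (mul_le_mul_of_nonneg_left ih (by linarith)).trans (B.lazy_surv_ratio hl (j + i))

lemma surv_compare {l : ℝ} (hl : IsSmallestEig (1 - B.Q) l) {j k j' k' : ℕ} (hj : j ≤ j')
    (hk : j < 2 * k) (hk' : 2 * k' < j') :
    (1 - l / 2) ^ (j' - j) * (B.surv k 0 - j / (2 * (k : ℝ) - j) ^ 2) ≤
      B.surv k' 0 + j' / ((j' : ℝ) - 2 * k') ^ 2 := by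
  have hl2 := B.eig_lt_two hl
  have hk2 : (j : ℝ) < 2 * k := by exact_mod_cast hk
  have hk2' : 2 * (k' : ℝ) < j' := by exact_mod_cast hk'
  have h1 : B.surv k 0 - j / (2 * (k : ℝ) - j) ^ 2 ≤ B.lazy.surv j 0 := by
    have e : (j : ℝ) * (1 / 2) * (1 - 1 / 2) / ((k : ℝ) - j / 2) ^ 2 = j / (2 * (k : ℝ) - j) ^ 2 := by
      have h3 : (k : ℝ) - j / 2 ≠ 0 := by linarith
      have h4 : 2 * (k : ℝ) - j ≠ 0 := by linarith
      rw [show (k : ℝ) - j / 2 = (2 * (k : ℝ) - j) / 2 by ring]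
      field_simp
      norm_num
    have := sum_binW_mul_le (p := 1 / 2) (by norm_num) (by norm_num) j
      (r := (k : ℝ) - j / 2) (by linarith) (fun i => B.surv k 0 - B.surv i 0)
      (fun i => by
        have := B.surv_nonneg i 0; have := B.surv_le_one k 0; linarith)
      (fun i hi => by
        have h2 := (abs_lt.mp hi).1
        have : (i : ℝ) < k := by linarith
        exact sub_nonpos.mpr (B.surv_antitone 0 (by exact_mod_cast this.le)))
    rw [e] at this
    simp only [mul_sub, Finset.sum_sub_distrib, ← Finset.sum_mul, sum_binW, one_mul,
      ← lazy_surv] at this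
    linarith
  have h2 : B.lazy.surv j' 0 ≤ B.surv k' 0 + j' / ((j' : ℝ) - 2 * k') ^ 2 := by
    have e : (j' : ℝ) * (1 / 2) * (1 - 1 / 2) / ((j' : ℝ) / 2 - k') ^ 2 =
        j' / ((j' : ℝ) - 2 * k') ^ 2 := by
      have h4 : (j' : ℝ) - 2 * k' ≠ 0 := by linarith
      rw [show (j' : ℝ) / 2 - k' = ((j' : ℝ) - 2 * k') / 2 by ring]
      field_simp
      norm_num
    have := sum_binW_mul_le (p := 1 / 2) (by norm_num) (by norm_num) j'
      (r := (j' : ℝ) / 2 - k') (by linarith) (fun i => B.surv i 0 - B.surv k' 0)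
      (fun i => by
        have := B.surv_nonneg k' 0; have := B.surv_le_one i 0; linarith)
      (fun i hi => by
        have h2 := (abs_lt.mp hi).2
        have : (k' : ℝ) < i := by linarith
        exact sub_nonpos.mpr (B.surv_antitone 0 (by exact_mod_cast this.le)))
    rw [e] at this
    simp only [mul_sub, Finset.sum_sub_distrib, ← Finset.sum_mul, sum_binW, one_mul,
      ← lazy_surv] at this
    linarith
  have h3 := B.lazy_surv_pow hl j (j' - j)
  rw [Nat.add_sub_cancel' hj] at h3
  exact ((mul_le_mul_of_nonneg_left h1 (_root_.pow_nonneg (by linarith) _)).trans h3).trans h2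

end SubBD

namespace BDChain

variable {n : ℕ} (c : BDChain n)

lemma hitSurv_self (M : Fin (n + 1)) (m : ℕ) : c.hitSurv M M m = 0 := by simp [hitSurv]

lemma hitSurv_zero {M x : Fin (n + 1)} (h : x ≠ M) : c.hitSurv M x 0 = 1 := by
  simp [hitSurv, h, Matrix.one_apply]

lemma hitSurv_succ {M x : Fin (n + 1)} (h : x ≠ M) (m : ℕ) :
    c.hitSurv M x (m + 1) = ∑ y, c.K x y * c.hitSurv M y m := by
  simp only [hitSurv, if_neg h, pow_succ', Matrix.mul_apply]
  rw [Finset.sum_comm]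
  refine Finset.sum_congr rfl fun y _ => ?_
  rw [← Finset.mul_sum]
  by_cases hy : y = M <;> simp [killed, h, hy]

lemma hitSurv_nonneg (M x : Fin (n + 1)) (m : ℕ) : 0 ≤ c.hitSurv M x m := by
  induction m generalizing x with
  | zero =>
    by_cases h : x = M
    · rw [h, hitSurv_self]
    · rw [hitSurv_zero _ h]; exact zero_le_one
  | succ m ih =>
    by_cases h : x = M
    · rw [h, hitSurv_self]
    · rw [hitSurv_succ _ h]
      exact Finset.sum_nonneg fun y _ => mul_nonneg (c.K_nonneg _ _) (ih y)

lemma K_eq_zero_of_lt {x y : Fin (n + 1)} (h : (x : ℕ) + 1 < y) : c.K x y = 0 := by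
  apply c.K_tridiag
  rw [abs_sub_comm]
  exact lt_of_lt_of_le (by omega) (le_abs_self _)

lemma K_eq_zero_of_gt {x y : Fin (n + 1)} (h : (y : ℕ) + 1 < x) : c.K x y = 0 := by
  apply c.K_tridiag
  exact lt_of_lt_of_le (by omega) (le_abs_self _)

lemma K_up_pos {x y : Fin (n + 1)} (h : (y : ℕ) = x + 1) : 0 < c.K x y := by
  have hx : (x : ℕ) < n := by omega
  have := (c.K_irred x hx).1
  rwa [show (⟨x + 1, by omega⟩ : Fin (n + 1)) = y from Fin.ext h.symm] at this

lemma reversible (x y : Fin (n + 1)) : c.pi x * c.K x y = c.pi y * c.K y x := by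
  have bal : ∀ y, ∑ x, (c.pi x * c.K x y - c.pi y * c.K y x) = 0 := fun y => by
    rw [Finset.sum_sub_distrib, c.pi_stat, ← Finset.mul_sum, c.K_rowSum, mul_one, sub_self]
  have key : ∀ k : ℕ, ∀ y : Fin (n + 1), (y : ℕ) = k → ∀ x < y,
      c.pi x * c.K x y - c.pi y * c.K y x = 0 := by
    intro k
    induction k with
    | zero => intro y hy x hx; exact absurd (show (x : ℕ) < y from hx) (by omega)
    | succ k ih =>
      intro y hy x hx
      have hx' : (x : ℕ) < y := hx
      rcases Nat.lt_or_ge ((x : ℕ) + 1) y with h | h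
      · rw [c.K_eq_zero_of_lt h, c.K_eq_zero_of_gt h]; ring
      have hxk : (x : ℕ) = k := by omega
      have hb := bal x
      rw [Finset.sum_eq_single y] at hb
      · linarith
      · intro w _ hw
        have hw' : (w : ℕ) ≠ y := fun h => hw (Fin.ext h)
        rcases lt_trichotomy w x with h1 | h1 | h1
        · exact ih x hxk w h1
        · rw [h1]; ring
        · have h1' : (x : ℕ) < w := h1
          rw [c.K_eq_zero_of_lt (x := x) (y := w) (by omega),
            c.K_eq_zero_of_gt (x := w) (y := x) (by omega)]; ring
      · simp
  rcases lt_trichotomy x y with h | h | h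
  · have := key y y rfl x h; linarith
  · rw [h]
  · have := key x x rfl y h; linarith

end BDChain

lemma sum_castLE {n : ℕ} (M : Fin (n + 1)) (f : Fin (n + 1) → ℝ) :
    ∑ b : Fin (M : ℕ), f (Fin.castLE M.isLt.le b) = ∑ y, if y < M then f y else 0 := by
  rw [← Finset.sum_filter]
  have : Finset.univ.filter (fun y => y < M) = Finset.univ.map (Fin.castLEEmb M.isLt.le) := by
    ext y
    simp only [Finset.mem_filter, Finset.mem_univ, true_and, Finset.mem_map, Fin.castLEEmb_apply]
    constructor
    · intro h; exact ⟨⟨y, h⟩, rfl⟩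
    · rintro ⟨b, rfl⟩; exact b.isLt
  rw [this, Finset.sum_map]
  rfl

namespace BDChain

variable {n : ℕ} (c : BDChain n)

lemma sum_K_lt_add {M x : Fin (n + 1)} (hx : x < M) (f : Fin (n + 1) → ℝ) :
    (∑ y, if y < M then c.K x y * f y else 0) + c.K x M * f M = ∑ y, c.K x y * f y := by
  have hx' : (x : ℕ) < M := hx
  have : c.K x M * f M = ∑ y, if y = M then c.K x y * f y else 0 := by simp
  rw [this, ← Finset.sum_add_distrib]
  refine Finset.sum_congr rfl fun y _ => ?_
  rcases lt_trichotomy y M with h | h | h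
  · simp [h, h.ne]
  · simp [h]
  · have h' : (M : ℕ) < y := h
    simp [h.not_gt, h.ne', c.K_eq_zero_of_lt (x := x) (y := y) (by omega)]

/-- The chain killed upon hitting `M`, restricted to the states below `M`. -/
def sub (M : Fin (n + 1)) : SubBD (M : ℕ) where
  Q := Matrix.of fun a b => c.K (Fin.castLE M.isLt.le a) (Fin.castLE M.isLt.le b)
  wt a := c.pi (Fin.castLE M.isLt.le a)
  nonneg _ _ := c.K_nonneg _ _
  tridiag _ _ h := c.K_tridiag _ _ h
  row_eq x h := by
    have h1 := c.sum_K_lt_add (M := M) (x := Fin.castLE M.isLt.le x) x.isLt (fun _ => 1)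
    have h2 := sum_castLE M (fun y => c.K (Fin.castLE M.isLt.le x) y)
    have h3 : c.K (Fin.castLE M.isLt.le x) M = 0 := c.K_eq_zero_of_lt h
    simp only [mul_one, h3, add_zero, c.K_rowSum] at h1
    rw [h1] at h2
    exact h2
  row_lt x h := by
    have h1 := c.sum_K_lt_add (M := M) (x := Fin.castLE M.isLt.le x) x.isLt (fun _ => 1)
    have h2 := sum_castLE M (fun y => c.K (Fin.castLE M.isLt.le x) y)
    have h3 : 0 < c.K (Fin.castLE M.isLt.le x) M := c.K_up_pos h.symm
    simp only [mul_one, c.K_rowSum] at h1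
    rw [← h2] at h1
    simp only [Matrix.of_apply]
    linarith
  up_pos _ _ h := c.K_up_pos h
  wt_pos _ := c.pi_pos _
  rev _ _ := c.reversible _ _
  wt_sum := by
    rw [sum_castLE M c.pi, ← c.pi_sum]
    refine Finset.sum_le_sum fun y _ => ?_
    split_ifs
    · exact le_rfl
    · exact (c.pi_pos y).le

lemma sub_Q (M : Fin (n + 1)) (a b : Fin (M : ℕ)) :
    (c.sub M).Q a b = c.K (Fin.castLE M.isLt.le a) (Fin.castLE M.isLt.le b) := rfl

lemma subIK_eq (M : Fin (n + 1)) : c.subIK M = 1 - (c.sub M).Q := by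
  ext a b
  simp only [subIK, Matrix.of_apply, Matrix.sub_apply, sub_Q, Matrix.one_apply,
    (Fin.castLE_injective M.isLt.le).eq_iff]

lemma hitSurv_castLE (M : Fin (n + 1)) (x : Fin (M : ℕ)) (m : ℕ) :
    c.hitSurv M (Fin.castLE M.isLt.le x) m = (c.sub M).surv m x := by
  induction m generalizing x with
  | zero =>
    rw [hitSurv_zero, SubBD.surv_zero]
    exact Fin.ne_of_lt x.isLt
  | succ m ih =>
    rw [hitSurv_succ _ (Fin.ne_of_lt x.isLt), SubBD.surv_succ, ← c.sum_K_lt_add (M := M) x.isLt,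
      hitSurv_self, mul_zero, add_zero,
      ← sum_castLE M (fun y => c.K (Fin.castLE M.isLt.le x) y * c.hitSurv M y m)]
    simp only [ih, sub_Q]

lemma hitSurv_eq_surv {M x : Fin (n + 1)} (hx : x < M) (m : ℕ) :
    c.hitSurv M x m = (c.sub M).surv m ⟨x, hx⟩ := c.hitSurv_castLE M ⟨x, hx⟩ m

lemma hitMean_eq_mean {M x : Fin (n + 1)} (hx : x < M) :
    c.hitMean M x = (c.sub M).mean ⟨x, hx⟩ := tsum_congr fun m => c.hitSurv_eq_surv hx m

lemma hitMean_self (M : Fin (n + 1)) : c.hitMean M M = 0 := by simp [hitMean, hitSurv_self]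

lemma hitVar_eq {M x : Fin (n + 1)} (hx : x < M) :
    c.hitVar M x = (c.sub M).mom2 ⟨x, hx⟩ - (c.sub M).mean ⟨x, hx⟩ ^ 2 := by
  rw [hitVar, hitMean_eq_mean _ hx]
  simp only [c.hitSurv_eq_surv hx]
  rfl

lemma hitSurv_le_one {M x : Fin (n + 1)} (hx : x ≤ M) (m : ℕ) : c.hitSurv M x m ≤ 1 := by
  rcases hx.eq_or_lt with rfl | h
  · rw [hitSurv_self]; exact zero_le_one
  · rw [c.hitSurv_eq_surv h]; exact SubBD.surv_le_one _ _ _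

lemma hitSurv_antitone {M x : Fin (n + 1)} (hx : x ≤ M) : Antitone (c.hitSurv M x) := by
  rcases hx.eq_or_lt with rfl | h
  · intro a b _; simp [hitSurv_self]
  · intro a b hab
    rw [c.hitSurv_eq_surv h, c.hitSurv_eq_surv h]
    exact SubBD.surv_antitone _ _ hab

lemma hitSurv_mono {M M' x : Fin (n + 1)} (hM : M ≤ M') (hx : x ≤ M) (m : ℕ) :
    c.hitSurv M x m ≤ c.hitSurv M' x m := by
  induction m generalizing x with
  | zero =>
    rcases hx.eq_or_lt with rfl | h
    · rw [hitSurv_self]; exact c.hitSurv_nonneg _ _ _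
    · rw [hitSurv_zero _ h.ne, hitSurv_zero _ (h.trans_le hM).ne]
  | succ m ih =>
    rcases hx.eq_or_lt with rfl | h
    · rw [hitSurv_self]; exact c.hitSurv_nonneg _ _ _
    · rw [hitSurv_succ _ h.ne, hitSurv_succ _ (h.trans_le hM).ne]
      refine Finset.sum_le_sum fun y _ => ?_
      have h' : (x : ℕ) < M := h
      rcases lt_or_ge M y with hy | hy
      · have hy' : (M : ℕ) < y := hy
        rw [c.K_eq_zero_of_lt (x := x) (y := y) (by omega)]; simp
      · exact mul_le_mul_of_nonneg_left (ih hy) (c.K_nonneg _ _)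

lemma hitSurv_summable {M x : Fin (n + 1)} (hx : x ≤ M) : Summable (c.hitSurv M x) := by
  rcases hx.eq_or_lt with rfl | h
  · simp only [funext (c.hitSurv_self x)]; exact summable_zero
  · have : NeZero (M : ℕ) := ⟨by have : (x : ℕ) < M := h; omega⟩
    simp only [funext (c.hitSurv_eq_surv h)]
    exact SubBD.surv_summable _ _

lemma hitSurv_summable_two {M x : Fin (n + 1)} (hx : x ≤ M) :
    Summable fun m : ℕ => (2 * (m : ℝ) + 1) * c.hitSurv M x m := by
  rcases hx.eq_or_lt with rfl | h
  · simp only [c.hitSurv_self x, mul_zero]; exact summable_zero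
  · have : NeZero (M : ℕ) := ⟨by have : (x : ℕ) < M := h; omega⟩
    simp only [c.hitSurv_eq_surv h]
    exact SubBD.surv_summable_two _ _

lemma hitMean_mono {M M' x : Fin (n + 1)} (hM : M ≤ M') (hx : x ≤ M) :
    c.hitMean M x ≤ c.hitMean M' x :=
  (c.hitSurv_summable hx).tsum_le_tsum (fun m => c.hitSurv_mono hM hx m)
    (c.hitSurv_summable (hx.trans hM))

lemma hitMean_nonneg (M x : Fin (n + 1)) : 0 ≤ c.hitMean M x :=
  tsum_nonneg fun m => c.hitSurv_nonneg M x m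

lemma hitMean_eq {M x : Fin (n + 1)} (hx : x < M) :
    c.hitMean M x = 1 + ∑ y, if y < M then c.K x y * c.hitMean M y else 0 := by
  have : NeZero (M : ℕ) := ⟨by have : (x : ℕ) < M := hx; omega⟩
  rw [hitMean_eq_mean _ hx, SubBD.mean_eq, ← sum_castLE M (fun y => c.K x y * c.hitMean M y)]
  congr 1
  refine Finset.sum_congr rfl fun b _ => ?_
  rw [c.hitMean_eq_mean (M := M) (x := Fin.castLE M.isLt.le b) b.isLt]
  rfl

lemma hitMean_le_add {M M' : Fin (n + 1)} (hM : M ≤ M') {x : Fin (n + 1)} (hx : x < M) :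
    c.hitMean M' x ≤ c.hitMean M x + c.hitMean M' M := by
  have : NeZero (M : ℕ) := ⟨by have : (x : ℕ) < M := hx; omega⟩
  rcases hM.eq_or_lt with rfl | hlt
  · rw [hitMean_self, add_zero]
  have := (c.sub M).nonneg_of_super
    (fun b => (fun y => c.hitMean M y + c.hitMean M' M - c.hitMean M' y) (Fin.castLE M.isLt.le b))
    (fun b => ?_) ⟨x, hx⟩
  · have h : Fin.castLE M.isLt.le ⟨x, hx⟩ = x := rfl
    simp only [h] at this
    linarith
  set z := Fin.castLE M.isLt.le b with hz
  have hzM : z < M := b.isLt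
  have hzM' : (z : ℕ) < M := hzM
  have e : ((c.sub M).Q *ᵥ fun b => (fun y => c.hitMean M y + c.hitMean M' M - c.hitMean M' y)
      (Fin.castLE M.isLt.le b)) b = ∑ y, if y < M then
        c.K z y * (c.hitMean M y + c.hitMean M' M - c.hitMean M' y) else 0 := by
    rw [← sum_castLE M (fun y => c.K z y * (c.hitMean M y + c.hitMean M' M - c.hitMean M' y))]
    rfl
  rw [e]
  have h1 := c.hitMean_eq hzM
  have h2 := c.hitMean_eq (hzM.trans hlt)
  have h3 := c.sum_K_lt_add hzM (c.hitMean M')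
  have h4 := c.sum_K_lt_add (hzM.trans hlt) (c.hitMean M')
  rw [hitMean_self, mul_zero, add_zero] at h4
  have h5 := c.sum_K_lt_add hzM (fun _ => 1)
  simp only [mul_one, c.K_rowSum] at h5
  have h6 : (∑ y, if y < M then c.K z y * (c.hitMean M y + c.hitMean M' M - c.hitMean M' y) else 0) =
      (∑ y, if y < M then c.K z y * c.hitMean M y else 0) +
      c.hitMean M' M * (∑ y, if y < M then c.K z y else 0) -
      ∑ y, if y < M then c.K z y * c.hitMean M' y else 0 := by
    rw [Finset.mul_sum, ← Finset.sum_add_distrib, ← Finset.sum_sub_distrib]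
    refine Finset.sum_congr rfl fun y _ => ?_
    split_ifs <;> ring
  rw [h6]
  have h7 := c.hitMean_nonneg M' M
  have h8 := c.K_nonneg z M
  have h9 : (∑ y, if y < M then c.K z y else 0) = 1 - c.K z M := by linarith
  rw [h9]
  show _ ≤ c.hitMean M z + c.hitMean M' M - c.hitMean M' z
  linarith

lemma hitMean_mul_piLow_le {M M' : Fin (n + 1)} (hM : M < M') {l : ℝ}
    (hl : IsSmallestEig (c.subIK M') l) : c.hitMean M' M * c.piLow M ≤ 1 / l := by
  have hM' : (M : ℕ) < M' := hM
  have : NeZero (M' : ℕ) := ⟨by omega⟩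
  rw [subIK_eq] at hl
  rw [hitMean_eq_mean _ hM]
  refine le_trans (le_of_eq ?_) ((c.sub M').mean_mul_wt_le hl ⟨M, hM⟩)
  congr 1
  rw [piLow, Finset.sum_filter]
  have := sum_castLE M' (fun y => if y ≤ M then c.pi y else 0)
  refine Eq.trans ?_ this.symm
  refine Finset.sum_congr rfl fun y _ => ?_
  by_cases h : y ≤ M
  · simp [h, h.trans_lt hM]
  · simp [h]

lemma eig_anti {M M' : Fin (n + 1)} (hM : M ≤ M') {l l' : ℝ}
    (hl : IsSmallestEig (c.subIK M) l) (hl' : IsSmallestEig (c.subIK M') l') : l' ≤ l := by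
  have hM' : (M : ℕ) ≤ M' := hM
  rw [subIK_eq] at hl hl'
  obtain ⟨v, hv0, hv⟩ := hl.1
  have hv1 := (c.sub M).mulVec_of_eig hv
  set f : Fin (n + 1) → ℝ := fun y => if h : (y : ℕ) < M then v ⟨y, h⟩ else 0 with hf
  have hfb : ∀ b : Fin (M : ℕ), f (Fin.castLE M.isLt.le b) = v b := fun b => dif_pos b.isLt
  have hf0 : ∀ y, ¬ y < M → f y = 0 := fun y hy => dif_neg hy
  have h1 := (c.sub M').rayleigh hl'.2 (fun b => f (Fin.castLE M'.isLt.le b))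
  have hres : ∀ g : Fin (n + 1) → ℝ, (∀ y, ¬ y < M → g y = 0) →
      ∑ b, g (Fin.castLE M'.isLt.le b) = ∑ b, g (Fin.castLE M.isLt.le b) := by
    intro g hg
    rw [sum_castLE M' g, sum_castLE M g]
    refine Finset.sum_congr rfl fun y _ => ?_
    by_cases h : y < M
    · simp [h, h.trans_le hM]
    · simp [hg y h]
  have h2 : ∑ x, (c.sub M').wt x * f (Fin.castLE M'.isLt.le x) ^ 2 =
      ∑ x, (c.sub M).wt x * v x ^ 2 := by
    have := hres (fun y => c.pi y * f y ^ 2) (fun y hy => by simp [hf0 y hy])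
    simp only [hfb] at this
    exact this
  have h3 : ∑ x, (c.sub M').wt x * f (Fin.castLE M'.isLt.le x) * (f (Fin.castLE M'.isLt.le x) -
      ∑ y, (c.sub M').Q x y * f (Fin.castLE M'.isLt.le y)) =
      ∑ x, (c.sub M).wt x * v x * (v x - ∑ y, (c.sub M).Q x y * v y) := by
    have hin : ∀ z, ∑ b : Fin (M' : ℕ), c.K z (Fin.castLE M'.isLt.le b) * f (Fin.castLE M'.isLt.le b) =
        ∑ b : Fin (M : ℕ), c.K z (Fin.castLE M.isLt.le b) * f (Fin.castLE M.isLt.le b) := fun z =>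
      hres (fun y => c.K z y * f y) (fun y hy => by simp [hf0 y hy])
    have := hres (fun z => c.pi z * f z * (f z - ∑ b : Fin (M : ℕ), c.K z (Fin.castLE M.isLt.le b) *
      f (Fin.castLE M.isLt.le b))) (fun y hy => by simp [hf0 y hy])
    simp only [← hin] at this
    simp only [hfb, hin] at this
    simp only [sub_Q, hin, hfb]
    exact this
  rw [h2, h3] at h1
  have h4 : ∀ x, ∑ y, (c.sub M).Q x y * v y = (1 - l) * v x := fun x => congrFun hv1 x
  simp only [h4] at h1
  have h5 : ∑ x, (c.sub M).wt x * v x * (v x - (1 - l) * v x) = l * ∑ x, (c.sub M).wt x * v x ^ 2 := by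
    rw [Finset.mul_sum]
    exact Finset.sum_congr rfl fun x _ => by ring
  rw [h5] at h1
  have hpos : 0 < ∑ x, (c.sub M).wt x * v x ^ 2 := by
    obtain ⟨x, hx⟩ := Function.ne_iff.mp hv0
    exact Finset.sum_pos' (fun x _ => mul_nonneg ((c.sub M).wt_pos x).le (sq_nonneg _))
      ⟨x, Finset.mem_univ _, mul_pos ((c.sub M).wt_pos x) (by
        have : v x ≠ 0 := hx
        positivity)⟩
  exact le_of_mul_le_mul_right h1 hpos

end BDChain

namespace BDChain

variable {n : ℕ} (c : BDChain n)

lemma pow_nonneg (m : ℕ) (x y : Fin (n + 1)) : 0 ≤ (c.K ^ m) x y := by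
  induction m generalizing x with
  | zero => simp only [pow_zero, Matrix.one_apply]; split_ifs <;> simp
  | succ m ih =>
    rw [pow_succ', Matrix.mul_apply]
    exact Finset.sum_nonneg fun w _ => mul_nonneg (c.K_nonneg _ _) (ih w)

lemma pow_rowSum (m : ℕ) (x : Fin (n + 1)) : ∑ y, (c.K ^ m) x y = 1 := by
  induction m generalizing x with
  | zero => simp [Matrix.one_apply]
  | succ m ih =>
    simp only [pow_succ', Matrix.mul_apply]
    rw [Finset.sum_comm]
    simp only [← Finset.mul_sum, ih, mul_one, c.K_rowSum]

lemma le_dTV (x : Fin (n + 1)) (m : ℕ) (A : Finset (Fin (n + 1))) :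
    ∑ y ∈ A, (c.K ^ m) x y - ∑ y ∈ A, c.pi y ≤ c.dTV x m :=
  le_ciSup (f := fun A : Finset (Fin (n + 1)) => ∑ y ∈ A, (c.K ^ m) x y - ∑ y ∈ A, c.pi y)
    (Set.finite_range _).bddAbove A

lemma dTV_nonneg (x : Fin (n + 1)) (m : ℕ) : 0 ≤ c.dTV x m := by
  simpa using c.le_dTV x m ∅

lemma dTV_le_one (x : Fin (n + 1)) (m : ℕ) : c.dTV x m ≤ 1 := by
  refine ciSup_le fun A => ?_
  have h1 : ∑ y ∈ A, (c.K ^ m) x y ≤ 1 := by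
    rw [← c.pow_rowSum m x]
    exact Finset.sum_le_sum_of_subset_of_nonneg (Finset.subset_univ A)
      fun y _ _ => c.pow_nonneg m x y
  have h2 : 0 ≤ ∑ y ∈ A, c.pi y := Finset.sum_nonneg fun y _ => (c.pi_pos y).le
  linarith

lemma sum_sub_mul_le_dTV (x : Fin (n + 1)) (m : ℕ) (f : Fin (n + 1) → ℝ) (hf0 : ∀ y, 0 ≤ f y)
    (hf1 : ∀ y, f y ≤ 1) : ∑ y, ((c.K ^ m) x y - c.pi y) * f y ≤ c.dTV x m := by
  refine le_trans ?_ (c.le_dTV x m (Finset.univ.filter fun y => 0 ≤ (c.K ^ m) x y - c.pi y))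
  rw [← Finset.sum_sub_distrib, Finset.sum_filter]
  refine Finset.sum_le_sum fun y _ => ?_
  split_ifs with h
  · exact mul_le_of_le_one_right h (hf1 y)
  · exact mul_nonpos_of_nonpos_of_nonneg (not_le.mp h).le (hf0 y)

lemma dTV_antitone (x : Fin (n + 1)) : Antitone (c.dTV x) := by
  refine antitone_nat_of_succ_le fun m => ciSup_le fun A => ?_
  have h := c.sum_sub_mul_le_dTV x m (fun y => ∑ z ∈ A, c.K y z)
    (fun y => Finset.sum_nonneg fun z _ => c.K_nonneg y z) (fun y => by
      rw [← c.K_rowSum y]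
      exact Finset.sum_le_sum_of_subset_of_nonneg (Finset.subset_univ A)
        fun z _ _ => c.K_nonneg y z)
  refine le_trans (le_of_eq ?_) h
  have e1 : ∑ z ∈ A, (c.K ^ (m + 1)) x z = ∑ y, (c.K ^ m) x y * ∑ z ∈ A, c.K y z := by
    simp only [Finset.mul_sum, pow_succ, Matrix.mul_apply]
    exact Finset.sum_comm
  have e2 : ∑ z ∈ A, c.pi z = ∑ y, c.pi y * ∑ z ∈ A, c.K y z := by
    simp only [Finset.mul_sum]
    rw [Finset.sum_comm]
    simp only [c.pi_stat]
  rw [e1, e2]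
  simp only [sub_mul, Finset.sum_sub_distrib]

lemma hitSurv_le_pow (M : Fin (n + 1)) (m : ℕ) {x : Fin (n + 1)} (hx : x ≤ M) :
    c.hitSurv M x m ≤ ∑ y with y < M, (c.K ^ m) x y := by
  induction m generalizing x with
  | zero =>
    rcases hx.eq_or_lt with rfl | h
    · rw [hitSurv_self]; exact Finset.sum_nonneg fun y _ => c.pow_nonneg _ _ _
    · rw [hitSurv_zero _ h.ne]
      have h1 : (c.K ^ 0) x x = 1 := by simp
      rw [← h1]
      exact Finset.single_le_sum (f := fun y => (c.K ^ 0) x y) (fun y _ => c.pow_nonneg 0 x y)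
        (Finset.mem_filter.mpr ⟨Finset.mem_univ x, h⟩)
  | succ m ih =>
    rcases hx.eq_or_lt with rfl | h
    · rw [hitSurv_self]; exact Finset.sum_nonneg fun y _ => c.pow_nonneg _ _ _
    · rw [hitSurv_succ _ h.ne]
      simp only [pow_succ', Matrix.mul_apply]
      rw [Finset.sum_comm]
      refine Finset.sum_le_sum fun y _ => ?_
      rw [← Finset.mul_sum]
      have h' : (x : ℕ) < M := h
      rcases lt_or_ge M y with hy | hy
      · have hy' : (M : ℕ) < y := hy
        rw [c.K_eq_zero_of_lt (x := x) (y := y) (by omega)]; simp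
      · exact mul_le_mul_of_nonneg_left (ih hy) (c.K_nonneg _ _)

lemma sum_lt_add_piHigh (M : Fin (n + 1)) : ∑ y with y < M, c.pi y + c.piHigh M = 1 := by
  rw [piHigh, Finset.sum_filter, ← Finset.sum_add_distrib, ← c.pi_sum]
  refine Finset.sum_congr rfl fun y _ => ?_
  by_cases h : y < M
  · simp [h, h.not_ge]
  · simp [h, not_lt.mp h]

lemma sum_gt_add_piLow (M : Fin (n + 1)) : ∑ y with M < y, c.pi y + c.piLow M = 1 := by
  rw [piLow, Finset.sum_filter, ← Finset.sum_add_distrib, ← c.pi_sum]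
  refine Finset.sum_congr rfl fun y _ => ?_
  by_cases h : M < y
  · simp [h, h.not_ge]
  · simp [h, not_lt.mp h]

lemma hitSurv_le_dTV (M : Fin (n + 1)) (m : ℕ) :
    c.hitSurv M 0 m ≤ c.dTV 0 m + (1 - c.piHigh M) := by
  have h1 := c.hitSurv_le_pow M m (Fin.zero_le M)
  have h2 := c.le_dTV 0 m (Finset.univ.filter (· < M))
  have h3 := c.sum_lt_add_piHigh M
  linarith

/-- A bound for the total variation coupling of two copies of the chain, in which the lower copy
is stopped on hitting `M`. -/
def coupleBound (M : Fin (n + 1)) : ℕ → Fin (n + 1) → Fin (n + 1) → ℝ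
  | 0, x, y => if x = M then (if M < y then 1 else 0) else 1
  | m + 1, x, y => if x = M then (if M < y then 1 else 0) else
      ∑ y', c.K y y' * ∑ x', c.K x x' * coupleBound M m x' y'

lemma coupleBound_self (M : Fin (n + 1)) (m : ℕ) (y : Fin (n + 1)) :
    c.coupleBound M m M y = if M < y then 1 else 0 := by
  cases m <;> simp [coupleBound]

lemma coupleBound_nonneg (M : Fin (n + 1)) (m : ℕ) (x y : Fin (n + 1)) :
    0 ≤ c.coupleBound M m x y := by
  induction m generalizing x y with
  | zero => unfold coupleBound; split_ifs <;> simp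
  | succ m ih =>
    unfold coupleBound
    split_ifs
    · simp
    · simp
    · exact Finset.sum_nonneg fun y' _ => mul_nonneg (c.K_nonneg _ _)
        (Finset.sum_nonneg fun x' _ => mul_nonneg (c.K_nonneg _ _) (ih _ _))

lemma sum_pi_coupleBound (M : Fin (n + 1)) (m : ℕ) (x : Fin (n + 1)) :
    ∑ y, c.pi y * c.coupleBound M m x y = 1 - (1 - c.hitSurv M x m) * c.piLow M := by
  have hM : ∀ m, ∑ y, c.pi y * c.coupleBound M m M y = 1 - c.piLow M := fun m => by
    simp only [coupleBound_self]
    have h := c.sum_gt_add_piLow M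
    rw [Finset.sum_filter] at h
    simp only [mul_ite, mul_one, mul_zero]
    linarith
  induction m generalizing x with
  | zero =>
    by_cases h : x = M
    · rw [h, hM, hitSurv_self]; ring
    · simp [coupleBound, h, c.pi_sum, hitSurv_zero]
  | succ m ih =>
    by_cases h : x = M
    · rw [h, hM, hitSurv_self]; ring
    · have e : ∑ y, c.pi y * c.coupleBound M (m + 1) x y =
          ∑ x', c.K x x' * ∑ y', c.pi y' * c.coupleBound M m x' y' := by
        simp only [coupleBound, if_neg h]
        simp only [Finset.mul_sum]
        rw [Finset.sum_comm]
        calc ∑ y', ∑ y, ∑ x', c.pi y * (c.K y y' * (c.K x x' * c.coupleBound M m x' y'))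
            = ∑ y', ∑ x', c.pi y' * (c.K x x' * c.coupleBound M m x' y') := by
              refine Finset.sum_congr rfl fun y' _ => ?_
              rw [Finset.sum_comm]
              refine Finset.sum_congr rfl fun x' _ => ?_
              simp only [← mul_assoc, ← Finset.sum_mul]
              rw [c.pi_stat]
          _ = ∑ x', ∑ y', c.K x x' * (c.pi y' * c.coupleBound M m x' y') := by
              rw [Finset.sum_comm]
              exact Finset.sum_congr rfl fun x' _ => Finset.sum_congr rfl fun y' _ => by ring
      rw [e, hitSurv_succ _ h]
      simp only [ih]
      have h1 := c.K_rowSum x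
      have e2 : ∑ x', c.K x x' * (1 - (1 - c.hitSurv M x' m) * c.piLow M) =
          (1 - c.piLow M) * (∑ x', c.K x x') + c.piLow M * ∑ x', c.K x x' * c.hitSurv M x' m := by
        simp only [Finset.mul_sum, ← Finset.sum_add_distrib]
        exact Finset.sum_congr rfl fun x' _ => by ring
      rw [e2, h1]; ring

lemma abs_sub_le_coupleBound (M : Fin (n + 1)) (f : ℕ → Fin (n + 1) → ℝ) {r : ℕ} {ε : ℝ}
    (hf0 : ∀ k x, 0 ≤ f k x) (hf1 : ∀ k x, f k x ≤ 1)
    (hf : ∀ k x, f (k + 1) x = ∑ y, c.K x y * f k y)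
    (hε : ∀ k, r ≤ k → ∀ x, |f (k + 1) x - f k x| ≤ ε) (m : ℕ) {x y : Fin (n + 1)}
    (hx : x ≤ M) (hxy : x ≤ y) :
    |f (m + r) x - f (m + r) y| ≤ c.coupleBound M m x y + ε := by
  have hε0 : 0 ≤ ε := (abs_nonneg _).trans (hε r le_rfl x)
  have hle : ∀ k x y, |f k x - f k y| ≤ 1 := fun k x y => by
    rw [abs_le]
    constructor <;> linarith [hf0 k x, hf1 k x, hf0 k y, hf1 k y]
  induction m generalizing x y with
  | zero =>
    rcases hxy.eq_or_lt with rfl | hlt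
    · rw [sub_self, abs_zero]; exact add_nonneg (c.coupleBound_nonneg _ _ _ _) hε0
    have : c.coupleBound M 0 x y = 1 := by
      unfold coupleBound
      split_ifs with h1 h2
      · rfl
      · exact absurd (h1 ▸ hlt) h2
      · rfl
    rw [this]
    linarith [hle (0 + r) x y]
  | succ m ih =>
    rcases hxy.eq_or_lt with rfl | hlt
    · rw [sub_self, abs_zero]; exact add_nonneg (c.coupleBound_nonneg _ _ _ _) hε0
    rcases hx.eq_or_lt with rfl | hxM
    · rw [coupleBound_self, if_pos hlt]
      linarith [hle (m + 1 + r) x y]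
    have hlt' : (x : ℕ) < y := hlt
    have hxM' : (x : ℕ) < M := hxM
    have e1 : f (m + 1 + r) x - f (m + 1 + r) y =
        ∑ y', c.K y y' * (f (m + r + 1) x - f (m + r) y') := by
      simp only [mul_sub, Finset.sum_sub_distrib, ← Finset.sum_mul, c.K_rowSum, one_mul, ← hf]
      rw [show m + 1 + r = m + r + 1 by ring]
    have e2 : c.coupleBound M (m + 1) x y + ε =
        ∑ y', c.K y y' * ((∑ x', c.K x x' * c.coupleBound M m x' y') + ε) := by
      simp only [coupleBound, if_neg hxM.ne, mul_add, Finset.sum_add_distrib, ← Finset.sum_mul,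
        c.K_rowSum, one_mul]
    rw [e1, e2]
    refine (Finset.abs_sum_le_sum_abs _ _).trans (Finset.sum_le_sum fun y' _ => ?_)
    rw [abs_mul, abs_of_nonneg (c.K_nonneg _ _)]
    rcases lt_trichotomy y' x with h | h | h
    · have h' : (y' : ℕ) < x := h
      rw [c.K_eq_zero_of_gt (x := y) (y := y') (by omega)]; simp
    · subst h
      refine mul_le_mul_of_nonneg_left ?_ (c.K_nonneg _ _)
      have h1 := hε (m + r) (by omega) y'
      have h2 : 0 ≤ ∑ x', c.K y' x' * c.coupleBound M m x' y' :=
        Finset.sum_nonneg fun x' _ => mul_nonneg (c.K_nonneg _ _) (c.coupleBound_nonneg _ _ _ _)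
      linarith
    · refine mul_le_mul_of_nonneg_left ?_ (c.K_nonneg _ _)
      have h' : (x : ℕ) < y' := h
      have e3 : f (m + r + 1) x - f (m + r) y' =
          ∑ x', c.K x x' * (f (m + r) x' - f (m + r) y') := by
        simp only [mul_sub, Finset.sum_sub_distrib, ← Finset.sum_mul, c.K_rowSum, one_mul, ← hf]
      have e4 : (∑ x', c.K x x' * c.coupleBound M m x' y') + ε =
          ∑ x', c.K x x' * (c.coupleBound M m x' y' + ε) := by
        simp only [mul_add, Finset.sum_add_distrib, ← Finset.sum_mul, c.K_rowSum, one_mul]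
      rw [e3, e4]
      refine (Finset.abs_sum_le_sum_abs _ _).trans (Finset.sum_le_sum fun x' _ => ?_)
      rw [abs_mul, abs_of_nonneg (c.K_nonneg _ _)]
      rcases Nat.lt_or_ge ((x : ℕ) + 1) x' with h3 | h3
      · rw [c.K_eq_zero_of_lt h3]; simp
      · refine mul_le_mul_of_nonneg_left (ih ?_ ?_) (c.K_nonneg _ _)
        · show (x' : ℕ) ≤ M
          omega
        · show (x' : ℕ) ≤ y'
          omega

lemma mulVec_mem_unit (f : Fin (n + 1) → ℝ) (hf0 : ∀ y, 0 ≤ f y) (hf1 : ∀ y, f y ≤ 1) (k : ℕ)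
    (x : Fin (n + 1)) : 0 ≤ ((c.K ^ k) *ᵥ f) x ∧ ((c.K ^ k) *ᵥ f) x ≤ 1 := by
  simp only [Matrix.mulVec, dotProduct]
  refine ⟨Finset.sum_nonneg fun y _ => mul_nonneg (c.pow_nonneg _ _ _) (hf0 y), ?_⟩
  rw [← c.pow_rowSum k x]
  exact Finset.sum_le_sum fun y _ => mul_le_of_le_one_right (c.pow_nonneg _ _ _) (hf1 y)

lemma abs_mulVec_succ_sub_le {δ : ℝ} (hδ0 : 0 < δ) (hδ1 : δ < 1) (hδ : ∀ x, δ ≤ c.K x x)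
    (f : Fin (n + 1) → ℝ) (hf0 : ∀ y, 0 ≤ f y) (hf1 : ∀ y, f y ≤ 1) (k : ℕ) (x : Fin (n + 1)) :
    |((c.K ^ (k + 1)) *ᵥ f) x - ((c.K ^ k) *ᵥ f) x| ≤
      1 / Real.sqrt (((k + 1 : ℕ) : ℝ) * (1 - δ) * δ) := by
  set p := 1 - δ with hp
  have hp0 : 0 < p := by linarith
  set P : Matrix (Fin (n + 1)) (Fin (n + 1)) ℝ := p⁻¹ • (c.K - δ • 1) with hP
  have hK : c.K = p • P + (1 - p) • (1 : Matrix (Fin (n + 1)) (Fin (n + 1)) ℝ) := by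
    rw [hP, smul_smul, mul_inv_cancel₀ hp0.ne', one_smul, hp, sub_sub_cancel, sub_add_cancel]
  have hP0 : ∀ x y, 0 ≤ P x y := by
    intro x y
    simp only [hP, Matrix.smul_apply, Matrix.sub_apply, Matrix.one_apply, smul_eq_mul]
    refine mul_nonneg (inv_nonneg.mpr hp0.le) ?_
    split_ifs with h
    · subst h; linarith [hδ x]
    · simpa using c.K_nonneg x y
  have hP1 : ∀ x, ∑ y, P x y = 1 := by
    intro x
    simp only [hP, Matrix.smul_apply, Matrix.sub_apply, Matrix.one_apply, smul_eq_mul,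
      ← Finset.mul_sum, Finset.sum_sub_distrib, c.K_rowSum]
    simp [← hp, hp0.ne']
  have hPf : ∀ i x, 0 ≤ ((P ^ i) *ᵥ f) x ∧ ((P ^ i) *ᵥ f) x ≤ 1 := by
    intro i
    induction i with
    | zero => intro x; simp [hf0, hf1]
    | succ i ih =>
      intro x
      rw [pow_succ', ← Matrix.mulVec_mulVec]
      show 0 ≤ ∑ y, P x y * ((P ^ i) *ᵥ f) y ∧ ∑ y, P x y * ((P ^ i) *ᵥ f) y ≤ 1
      refine ⟨Finset.sum_nonneg fun y _ => mul_nonneg (hP0 x y) (ih y).1, ?_⟩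
      rw [← hP1 x]
      exact Finset.sum_le_sum fun y _ => mul_le_of_le_one_right (hP0 x y) (ih y).2
  clear_value P
  have e : ((c.K ^ (k + 1)) *ᵥ f) x - ((c.K ^ k) *ᵥ f) x =
      p * ∑ i ∈ Finset.range (k + 1), binW p k i * (((P ^ (i + 1)) *ᵥ f) x - ((P ^ i) *ᵥ f) x) := by
    have h1 : (c.K ^ (k + 1)) *ᵥ f - (c.K ^ k) *ᵥ f = p • ((c.K ^ k) *ᵥ (P *ᵥ f) - (c.K ^ k) *ᵥ f) := by
      have h2 : c.K *ᵥ f = p • (P *ᵥ f) + (1 - p) • f := by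
        rw [hK]
        rw [Matrix.add_mulVec, Matrix.smul_mulVec, Matrix.smul_mulVec, Matrix.one_mulVec]
      rw [pow_succ, ← Matrix.mulVec_mulVec, h2, Matrix.mulVec_add, Matrix.mulVec_smul,
        Matrix.mulVec_smul]
      funext y
      simp only [Pi.sub_apply, Pi.add_apply, Pi.smul_apply, smul_eq_mul]
      ring
    have h3 := congrFun h1 x
    simp only [Pi.sub_apply, Pi.smul_apply, smul_eq_mul] at h3
    rw [h3]
    congr 1
    have hL := lazy_pow_mulVec P p k
    rw [← hK] at hL
    rw [hL, hL, ← Finset.sum_sub_distrib]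
    refine Finset.sum_congr rfl fun i _ => ?_
    rw [Matrix.mulVec_mulVec, ← pow_succ, mul_sub]
  rw [e, abs_mul, abs_of_pos hp0]
  have h4 := abs_sum_binW_diff_le hp0 (by linarith : p < 1) k (fun i => ((P ^ i) *ᵥ f) x)
    (fun i => abs_le.mpr ⟨by linarith [(hPf i x).1], (hPf i x).2⟩)
  rw [show 1 - p = δ by rw [hp]; ring] at h4
  refine le_trans (mul_le_of_le_one_left (abs_nonneg _) (by linarith)) h4

lemma dTV_add_le {δ : ℝ} (hδ0 : 0 < δ) (hδ1 : δ < 1) (hδ : ∀ x, δ ≤ c.K x x) (M : Fin (n + 1))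
    (m r : ℕ) : c.dTV 0 (m + r) ≤ 1 - (1 - c.hitSurv M 0 m) * c.piLow M +
      1 / Real.sqrt (((r + 1 : ℕ) : ℝ) * (1 - δ) * δ) := by
  refine ciSup_le fun A => ?_
  set f : Fin (n + 1) → ℝ := fun y => if y ∈ A then 1 else 0 with hf
  have hf0 : ∀ y, 0 ≤ f y := fun y => by simp only [hf]; split_ifs <;> simp
  have hf1 : ∀ y, f y ≤ 1 := fun y => by simp only [hf]; split_ifs <;> simp
  set F : ℕ → Fin (n + 1) → ℝ := fun k => (c.K ^ k) *ᵥ f with hF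
  set ε := 1 / Real.sqrt (((r + 1 : ℕ) : ℝ) * (1 - δ) * δ) with hε
  have hFs : ∀ k x, F (k + 1) x = ∑ y, c.K x y * F k y := fun k x => by
    simp only [hF]
    rw [pow_succ', ← Matrix.mulVec_mulVec]; rfl
  have h1δ : 0 < 1 - δ := by linarith
  have hstep : ∀ k, r ≤ k → ∀ x, |F (k + 1) x - F k x| ≤ ε := fun k hk x => by
    refine (c.abs_mulVec_succ_sub_le hδ0 hδ1 hδ f hf0 hf1 k x).trans ?_
    rw [hε]
    gcongr
  have hb := fun y => c.abs_sub_le_coupleBound M F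
    (fun k x => (c.mulVec_mem_unit f hf0 hf1 k x).1)
    (fun k x => (c.mulVec_mem_unit f hf0 hf1 k x).2) hFs hstep m (Fin.zero_le M) (Fin.zero_le y)
  have hstat : ∀ k, ∑ y, c.pi y * F k y = ∑ y ∈ A, c.pi y := by
    intro k
    induction k with
    | zero => simp [hF, hf]
    | succ k ih =>
      rw [← ih]
      simp only [hFs, Finset.mul_sum]
      rw [Finset.sum_comm]
      simp only [← mul_assoc, ← Finset.sum_mul, c.pi_stat]
  have h0 : ∑ y ∈ A, (c.K ^ (m + r)) 0 y = F (m + r) 0 := by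
    simp [hF, hf, Matrix.mulVec, dotProduct]
  rw [h0, ← hstat (m + r), ← c.sum_pi_coupleBound M m 0]
  have e1 : F (m + r) 0 - ∑ y, c.pi y * F (m + r) y =
      ∑ y, c.pi y * (F (m + r) 0 - F (m + r) y) := by
    simp only [mul_sub, Finset.sum_sub_distrib, ← Finset.sum_mul, c.pi_sum, one_mul]
  have e2 : ∑ y, c.pi y * c.coupleBound M m 0 y + ε =
      ∑ y, c.pi y * (c.coupleBound M m 0 y + ε) := by
    simp only [mul_add, Finset.sum_add_distrib, ← Finset.sum_mul, c.pi_sum, one_mul]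
  rw [e1, e2]
  exact Finset.sum_le_sum fun y _ =>
    mul_le_mul_of_nonneg_left ((le_abs_self _).trans (hb y)) (c.pi_pos y).le

lemma tendsto_sqrt_bound {δ : ℝ} (hδ0 : 0 < δ) (hδ1 : δ < 1) :
    Tendsto (fun r : ℕ => 1 / Real.sqrt (((r + 1 : ℕ) : ℝ) * (1 - δ) * δ)) atTop (nhds 0) := by
  have h1 : Tendsto (fun r : ℕ => ((r + 1 : ℕ) : ℝ)) atTop atTop :=
    tendsto_natCast_atTop_atTop.comp (tendsto_add_atTop_nat 1)
  have h2 : Tendsto (fun r : ℕ => ((r + 1 : ℕ) : ℝ) * (1 - δ) * δ) atTop atTop :=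
    (h1.atTop_mul_const (by linarith)).atTop_mul_const hδ0
  simp only [one_div]
  exact (Real.tendsto_sqrt_atTop.comp h2).inv_tendsto_atTop

lemma tendsto_dTV {δ : ℝ} (hδ0 : 0 < δ) (hδ1 : δ < 1) (hδ : ∀ x, δ ≤ c.K x x) :
    Tendsto (c.dTV 0) atTop (nhds 0) := by
  have hlow : c.piLow (Fin.last n) = 1 := by
    rw [piLow, ← c.pi_sum]
    exact Finset.sum_congr rfl fun y _ => if_pos (Fin.le_last y)
  have h1 : Tendsto (fun m => c.hitSurv (Fin.last n) 0 m +
      1 / Real.sqrt (((m + 1 : ℕ) : ℝ) * (1 - δ) * δ)) atTop (nhds 0) := by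
    simpa using (c.hitSurv_summable (Fin.zero_le (Fin.last n))).tendsto_atTop_zero.add
      (tendsto_sqrt_bound hδ0 hδ1)
  have h2 : Tendsto (fun m => c.dTV 0 (m + m)) atTop (nhds 0) := by
    refine squeeze_zero (fun m => c.dTV_nonneg _ _) (fun m => ?_) h1
    have := c.dTV_add_le hδ0 hδ1 hδ (Fin.last n) m m
    rw [hlow] at this
    linarith
  rw [Metric.tendsto_atTop] at h2 ⊢
  intro ε hε
  obtain ⟨N, hN⟩ := h2 ε hε
  refine ⟨N + N, fun m hm => ?_⟩
  have h3 := hN N le_rfl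
  rw [Real.dist_eq, sub_zero, abs_of_nonneg (c.dTV_nonneg _ _)] at h3 ⊢
  exact (c.dTV_antitone 0 hm).trans_lt h3

end BDChain

/-- `d` drops from `1` to `0` around `t`. -/
def SharpTransition (d : ℕ → ℕ → ℝ) (t : ℕ → ℝ) : Prop :=
  ∀ ε ∈ Set.Ioo (0 : ℝ) 1, Tendsto (fun n => d n ⌊(1 + ε) * t n⌋₊) atTop (nhds 0) ∧
    Tendsto (fun n => d n ⌊(1 - ε) * t n⌋₊) atTop (nhds 1)

lemma tendsto_div_nhds_one_of_forall {x y : ℕ → ℝ} (hy : ∀ᶠ n in atTop, 0 < y n)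
    (h1 : ∀ ε ∈ Set.Ioo (0 : ℝ) 1, ∀ᶠ n in atTop, (1 - ε) * x n ≤ (1 + ε) * y n)
    (h2 : ∀ ε ∈ Set.Ioo (0 : ℝ) 1, ∀ᶠ n in atTop, (1 - ε) * y n ≤ (1 + ε) * x n) :
    Tendsto (fun n => x n / y n) atTop (nhds 1) := by
  rw [Metric.tendsto_nhds]
  intro η hη
  set ε := min (η / 8) (1 / 2) with hε
  have e1 : ε ≤ η / 8 := min_le_left _ _
  have e2 : ε ≤ 1 / 2 := min_le_right _ _
  have e0 : 0 < ε := lt_min (by positivity) (by norm_num)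
  have hε' : ε ∈ Set.Ioo (0 : ℝ) 1 := ⟨e0, by linarith⟩
  filter_upwards [hy, h1 ε hε', h2 ε hε'] with n hn h3 h4
  rw [Real.dist_eq, abs_lt]
  have h5 : (1 - ε) * (x n / y n) ≤ 1 + ε := by
    rw [← mul_div_assoc, div_le_iff₀ hn]; exact h3
  have h6 : 1 - ε ≤ (1 + ε) * (x n / y n) := by
    rw [← mul_div_assoc, le_div_iff₀ hn]; exact h4
  constructor <;> nlinarith

lemma mixD_le {d : ℕ → ℝ} {ε : ℝ} {m : ℕ} (h : d m ≤ ε) : mixD d ε ≤ m := Nat.sInf_le h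

lemma lt_mixD {d : ℕ → ℝ} (hd : Antitone d) (hd0 : Tendsto d atTop (nhds 0)) {ε : ℝ}
    (hε : 0 < ε) {m : ℕ} (h : ε < d m) : m < mixD d ε := by
  by_contra! hle
  have hne : {m : ℕ | d m ≤ ε}.Nonempty :=
    (hd0.eventually (ge_mem_nhds hε)).exists
  have hmem : d (mixD d ε) ≤ ε := Nat.sInf_mem hne
  linarith [hd hle]

lemma cutoffWith_mixD_iff {d : ℕ → ℕ → ℝ} {t : ℕ → ℝ} (hd : ∀ n, Antitone (d n))
    (hnn : ∀ n m, 0 ≤ d n m) (hle : ∀ n m, d n m ≤ 1)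
    (hd0 : ∀ n, Tendsto (d n) atTop (nhds 0)) (ht : ∀ᶠ n in atTop, 0 < t n) :
    cutoffWith (fun ε n => ((mixD (d n) ε : ℕ) : ℝ)) t ↔ SharpTransition d t := by
  constructor
  · intro h ε hε
    constructor
    · rw [Metric.tendsto_nhds]
      intro η hη
      set η' := min (η / 2) (1 / 2) with hη'
      have e1 : η' ≤ η / 2 := min_le_left _ _
      have e0 : η' ∈ Set.Ioo (0 : ℝ) 1 :=
        ⟨lt_min (by positivity) (by norm_num), (min_le_right _ _).trans_lt (by norm_num)⟩
      filter_upwards [ht, (h η' e0).eventually (gt_mem_nhds (by linarith [hε.1] : 1 < 1 + ε))]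
        with n hn h1
      rw [div_lt_iff₀ hn] at h1
      rw [Real.dist_eq, sub_zero, abs_of_nonneg (hnn _ _)]
      have h2 : mixD (d n) η' ≤ ⌊(1 + ε) * t n⌋₊ := Nat.le_floor h1.le
      by_contra! h3
      exact (lt_mixD (hd n) (hd0 n) e0.1 (m := ⌊(1 + ε) * t n⌋₊) (by linarith [e0.1])).not_ge h2
    · rw [Metric.tendsto_nhds]
      intro η hη
      set η' := min (η / 2) (1 / 2) with hη'
      have e1 : η' ≤ η / 2 := min_le_left _ _
      have e2 : 0 < η' := lt_min (by positivity) (by norm_num)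
      have e3 : η' ≤ 1 / 2 := min_le_right _ _
      filter_upwards [ht, (h (1 - η') ⟨by linarith, by linarith⟩).eventually
        (lt_mem_nhds (by linarith [hε.1] : 1 - ε < 1))] with n hn h1
      rw [lt_div_iff₀ hn] at h1
      rw [Real.dist_eq, abs_sub_comm, abs_of_nonneg (by linarith [hle n ⌊(1 - ε) * t n⌋₊])]
      by_contra! h3
      have h4 : mixD (d n) (1 - η') ≤ ⌊(1 - ε) * t n⌋₊ := mixD_le (by linarith)
      have h5 : ((mixD (d n) (1 - η') : ℕ) : ℝ) ≤ (1 - ε) * t n :=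
        (Nat.cast_le.mpr h4).trans (Nat.floor_le (mul_nonneg (by linarith [hε.2]) hn.le))
      linarith
  · intro h η hη
    refine tendsto_div_nhds_one_of_forall ht (fun ε hε => ?_) (fun ε hε => ?_)
    · filter_upwards [ht, (h ε hε).1.eventually (gt_mem_nhds hη.1)] with n hn h1
      have h2 : ((mixD (d n) η : ℕ) : ℝ) ≤ (1 + ε) * t n :=
        (Nat.cast_le.mpr (mixD_le h1.le)).trans
          (Nat.floor_le (mul_nonneg (by linarith [hε.1]) hn.le))
      have h3 : (0 : ℝ) ≤ (mixD (d n) η : ℕ) := Nat.cast_nonneg _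
      nlinarith [hε.1]
    · filter_upwards [ht, (h ε hε).2.eventually (lt_mem_nhds hη.2)] with n hn h1
      have h2 := Nat.lt_of_floor_lt (lt_mixD (hd n) (hd0 n) hη.1 h1)
      have h3 : (0 : ℝ) ≤ (mixD (d n) η : ℕ) := Nat.cast_nonneg _
      nlinarith [hε.1]

/-- Bounds relating the tail `s` of a hitting time to its mean `u`, its variance `v` and
the smallest eigenvalue `l` of the killed chain. -/
structure HitBounds (δ : ℝ) (s : ℕ → ℝ) (u v l : ℝ) : Prop where
  mul_le : ∀ m, u * (1 - s m) ≤ m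
  le_mul : ∀ m : ℕ, (m : ℝ) * s m ≤ u
  lower : ∀ m : ℕ, (m : ℝ) ≤ u → (1 - s m) * (u - m) ^ 2 ≤ v
  upper : ∀ m : ℕ, u ≤ (m : ℝ) + 1 → s m * ((m : ℝ) + 1 - u) ^ 2 ≤ v
  l_pos : 0 < l
  one_le : 1 ≤ u
  le_var : δ * u ≤ v
  inv_sq_le : 1 / l ^ 2 ≤ v + u
  var_le : v + u ≤ u / l
  compare : ∀ j j' k k' : ℕ, j ≤ j' → j < 2 * k → 2 * k' < j' →
    (1 - l / 2) ^ (j' - j) * (s k - j / (2 * (k : ℝ) - j) ^ 2) ≤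
      s k' + j' / ((j' : ℝ) - 2 * k') ^ 2

lemma HitBounds.eig_le_one {δ : ℝ} {s : ℕ → ℝ} {u v l : ℝ} (hδ : 0 < δ)
    (h : HitBounds δ s u v l) : l ≤ 1 := by
  have hu : 0 < u := by linarith [h.one_le]
  have hv : 0 < v := (mul_pos hδ hu).trans_le h.le_var
  have h1 : u ≤ u / l := by linarith [h.var_le]
  rw [le_div_iff₀ h.l_pos] at h1
  exact le_of_mul_le_mul_left (by linarith) hu

lemma HitBounds.compare_floor {δ : ℝ} {s : ℕ → ℝ} {u v l : ℝ} (hδ : 0 < δ)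
    (h : HitBounds δ s u v l) {ε t L : ℝ} (e0 : 0 < ε) (e1 : ε ≤ 1 / 4) (ht : 2 ≤ ε * t)
    (hlt : t * l < L) (hs : 0 ≤ s ⌊(1 - ε) * t⌋₊ - 2 / ε ^ 2 * t⁻¹) :
    (1 - 4 * ε * L - L * t⁻¹) * (s ⌊(1 - ε) * t⌋₊ - 2 / ε ^ 2 * t⁻¹) ≤
      s ⌊(1 + ε) * t⌋₊ + 1 / ε ^ 2 * t⁻¹ := by
  have ht8 : 8 ≤ t := by
    by_contra! hc
    linarith [mul_lt_mul_of_pos_left hc e0]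
  have htp : 0 < t := by linarith
  have het : 0 < ε * t := mul_pos e0 htp
  have het4 : ε * t ≤ 1 / 4 * t := mul_le_mul_of_nonneg_right e1 htp.le
  set k := ⌊(1 - ε) * t⌋₊ with hk
  set k' := ⌊(1 + ε) * t⌋₊ with hk'
  set j := ⌊2 * (1 - 2 * ε) * t⌋₊ with hj
  set j' := ⌈2 * (1 + 2 * ε) * t⌉₊ with hj'
  have k1 : (1 - ε) * t < k + 1 := Nat.lt_floor_add_one _
  have k2 : (k' : ℝ) ≤ (1 + ε) * t := Nat.floor_le (by positivity)
  have j1 : (j : ℝ) ≤ 2 * (1 - 2 * ε) * t := Nat.floor_le (mul_nonneg (by linarith) htp.le)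
  have j2 : 2 * (1 - 2 * ε) * t < j + 1 := Nat.lt_floor_add_one _
  have j3 : 2 * (1 + 2 * ε) * t ≤ j' := Nat.le_ceil _
  have j4 : (j' : ℝ) < 2 * (1 + 2 * ε) * t + 1 := Nat.ceil_lt_add_one (by positivity)
  have c1 : j ≤ j' := by
    have : (j : ℝ) ≤ j' := by linarith
    exact_mod_cast this
  have d1 : ε * t ≤ 2 * (k : ℝ) - j := by linarith
  have d2 : 2 * ε * t ≤ (j' : ℝ) - 2 * k' := by linarith
  have c2 : j < 2 * k := by
    have : (j : ℝ) < 2 * k := by linarith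
    exact_mod_cast this
  have c3 : 2 * k' < j' := by
    have : 2 * (k' : ℝ) < j' := by linarith
    exact_mod_cast this
  have hcmp := h.compare j j' k k' c1 c2 c3
  have b1 : (j : ℝ) / (2 * (k : ℝ) - j) ^ 2 ≤ 2 / ε ^ 2 * t⁻¹ := by
    calc (j : ℝ) / (2 * (k : ℝ) - j) ^ 2 ≤ (2 * t) / (ε * t) ^ 2 := by
          gcongr
          linarith
      _ = _ := by field_simp
  have b2 : (j' : ℝ) / ((j' : ℝ) - 2 * k') ^ 2 ≤ 1 / ε ^ 2 * t⁻¹ := by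
    calc (j' : ℝ) / ((j' : ℝ) - 2 * k') ^ 2 ≤ (4 * t) / (2 * ε * t) ^ 2 := by
          gcongr
          linarith
      _ = _ := by field_simp; norm_num
  have hl := h.l_pos
  have hl1 := h.eig_le_one hδ
  have hllt : l ≤ L * t⁻¹ := by
    rw [← div_eq_mul_inv, le_div_iff₀ htp]; linarith
  have b3 : 1 - 4 * ε * L - L * t⁻¹ ≤ (1 - l / 2) ^ (j' - j) := by
    have h8 := one_add_mul_le_pow (by linarith : (-2 : ℝ) ≤ -(l / 2)) (j' - j)
    rw [← sub_eq_add_neg] at h8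
    refine le_trans ?_ h8
    rw [Nat.cast_sub c1]
    have h9 : (j' : ℝ) - j ≤ 8 * ε * t + 2 := by linarith
    have h10 : ((j' : ℝ) - j) * (l / 2) ≤ (8 * ε * t + 2) * (l / 2) :=
      mul_le_mul_of_nonneg_right h9 (by linarith)
    have h11 : ε * (t * l) ≤ ε * L := mul_le_mul_of_nonneg_left hlt.le e0.le
    linarith
  have b4 : (1 - 4 * ε * L - L * t⁻¹) * (s k - 2 / ε ^ 2 * t⁻¹) ≤
      (1 - l / 2) ^ (j' - j) * (s k - j / (2 * (k : ℝ) - j) ^ 2) :=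
    mul_le_mul b3 (by linarith) hs (pow_nonneg (by linarith) _)
  linarith

/-- Bounds relating two hitting times, the first of a state below the state of the second. -/
structure HitMono (a : ℝ) (s s' : ℕ → ℝ) (u u' l lam' : ℝ) : Prop where
  surv_le : ∀ m, s m ≤ s' m
  mean_le : u ≤ u'
  mean_le_add : u' ≤ u + 1 / (a * lam')
  eig_le : lam' ≤ l

/-- The facts on distances to stationarity `d`, tails `s a` of the hitting times of `a`-quantiles,
their means `u a`, variances `v a` and eigenvalues `l a`, from which cutoff is characterized. -/
structure CutoffProfile (δ : ℝ) (er : ℕ → ℝ) (d : ℕ → ℕ → ℝ) (s : ℝ → ℕ → ℕ → ℝ)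
    (u v l : ℝ → ℕ → ℝ) : Prop where
  δ_pos : 0 < δ
  er_tendsto : Tendsto er atTop (nhds 0)
  d_anti : ∀ n, Antitone (d n)
  d_nonneg : ∀ n m, 0 ≤ d n m
  d_le_one : ∀ n m, d n m ≤ 1
  d_tendsto : ∀ n, Tendsto (d n) atTop (nhds 0)
  s_anti : ∀ a n, Antitone (s a n)
  s_nonneg : ∀ a n m, 0 ≤ s a n m
  s_le_one : ∀ a n m, s a n m ≤ 1
  d_add_le : ∀ a ∈ Set.Ioo (0 : ℝ) 1, ∀ n m r, d n (m + r) ≤ 1 - (1 - s a n m) * a + er r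
  s_le_d : ∀ a ∈ Set.Ioo (0 : ℝ) 1, ∀ n m, s a n m ≤ d n m + a
  bounds : ∀ a ∈ Set.Ioo (0 : ℝ) 1, ∀ᶠ n in atTop, HitBounds δ (s a n) (u a n) (v a n) (l a n)
  mono : ∀ a ∈ Set.Ioo (0 : ℝ) 1, ∀ b ∈ Set.Ioo (0 : ℝ) 1, a < b →
    ∀ᶠ n in atTop, HitMono a (s a n) (s b n) (u a n) (u b n) (l a n) (l b n)

namespace CutoffProfile

variable {δ : ℝ} {er : ℕ → ℝ} {d : ℕ → ℕ → ℝ} {s : ℝ → ℕ → ℕ → ℝ} {u v l : ℝ → ℕ → ℝ}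

lemma cutoffWith_iff (P : CutoffProfile δ er d s u v l) {t : ℕ → ℝ}
    (ht : ∀ᶠ n in atTop, 0 < t n) :
    cutoffWith (fun ε n => ((mixD (d n) ε : ℕ) : ℝ)) t ↔ SharpTransition d t :=
  cutoffWith_mixD_iff P.d_anti P.d_nonneg P.d_le_one P.d_tendsto ht

lemma eig_of_var (P : CutoffProfile δ er d s u v l) {a : ℝ} (ha : a ∈ Set.Ioo (0 : ℝ) 1)
    (h : Tendsto (fun n => u a n / Real.sqrt (v a n)) atTop atTop) :
    Tendsto (fun n => u a n * l a n) atTop atTop := by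
  set C := Real.sqrt (1 + 1 / δ) with hC
  have hδ := P.δ_pos
  have hC0 : 0 < C := Real.sqrt_pos.mpr (by positivity)
  refine tendsto_atTop_mono' _ ?_ (h.const_mul_atTop (inv_pos.mpr hC0))
  filter_upwards [P.bounds a ha] with n hn
  have hu : 0 < u a n := by linarith [hn.one_le]
  have hv : 0 < v a n := (mul_pos hδ hu).trans_le hn.le_var
  have hl := hn.l_pos
  have h1 : 1 / l a n ^ 2 ≤ (1 + 1 / δ) * v a n := by
    refine hn.inv_sq_le.trans ?_
    have : u a n ≤ v a n / δ := by rw [le_div_iff₀ hδ]; linarith [hn.le_var]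
    rw [add_mul, one_mul, one_div_mul_eq_div]; linarith
  have h2 : 1 / l a n ≤ C * Real.sqrt (v a n) := by
    rw [hC, ← Real.sqrt_mul (by positivity)]
    refine Real.le_sqrt_of_sq_le ?_
    rwa [div_pow, one_pow]
  have hs : 0 < Real.sqrt (v a n) := Real.sqrt_pos.mpr hv
  rw [div_le_iff₀ hl] at h2
  rw [← div_eq_inv_mul, div_div, div_le_iff₀ (by positivity)]
  nlinarith

lemma var_of_eig (P : CutoffProfile δ er d s u v l) {a : ℝ} (ha : a ∈ Set.Ioo (0 : ℝ) 1)
    (h : Tendsto (fun n => u a n * l a n) atTop atTop) :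
    Tendsto (fun n => u a n / Real.sqrt (v a n)) atTop atTop := by
  refine tendsto_atTop_mono' _ ?_ (Real.tendsto_sqrt_atTop.comp h)
  filter_upwards [P.bounds a ha] with n hn
  have hu : 0 < u a n := by linarith [hn.one_le]
  have hv : 0 < v a n := (mul_pos P.δ_pos hu).trans_le hn.le_var
  have hl := hn.l_pos
  have h1 : v a n * l a n ≤ u a n := by
    rw [← le_div_iff₀ hl]; linarith [hn.var_le]
  refine Real.sqrt_le_iff.mpr ⟨by positivity, ?_⟩
  rw [div_pow, Real.sq_sqrt hv.le, le_div_iff₀ hv]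
  nlinarith

lemma tendsto_mean (P : CutoffProfile δ er d s u v l) {a : ℝ} (ha : a ∈ Set.Ioo (0 : ℝ) 1)
    (h : Tendsto (fun n => u a n * l a n) atTop atTop) : Tendsto (u a) atTop atTop := by
  refine tendsto_atTop_mono' _ ?_ h
  filter_upwards [P.bounds a ha] with n hn
  have hu : 0 < u a n := by linarith [hn.one_le]
  exact mul_le_of_le_one_right hu.le (hn.eig_le_one P.δ_pos)

lemma tendsto_surv_one (P : CutoffProfile δ er d s u v l) {a : ℝ} (ha : a ∈ Set.Ioo (0 : ℝ) 1)
    (h : Tendsto (fun n => u a n * l a n) atTop atTop) {ε : ℝ} (hε : ε ∈ Set.Ioo (0 : ℝ) 1) :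
    Tendsto (fun n => s a n ⌊(1 - ε) * u a n⌋₊) atTop (nhds 1) := by
  have h1 : Tendsto (fun n => 1 - (ε ^ 2)⁻¹ * (u a n * l a n)⁻¹) atTop (nhds 1) := by
    simpa using (h.inv_tendsto_atTop.const_mul ((ε ^ 2)⁻¹)).const_sub 1
  refine tendsto_of_tendsto_of_tendsto_of_le_of_le' h1 tendsto_const_nhds ?_
    (Eventually.of_forall fun n => P.s_le_one _ _ _)
  filter_upwards [P.bounds a ha] with n hn
  have hu : 0 < u a n := by linarith [hn.one_le]
  have hl := hn.l_pos
  have e0 := hε.1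
  have hm : ((⌊(1 - ε) * u a n⌋₊ : ℕ) : ℝ) ≤ (1 - ε) * u a n :=
    Nat.floor_le (mul_nonneg (by linarith [hε.2]) hu.le)
  have h2 := hn.lower ⌊(1 - ε) * u a n⌋₊ (by nlinarith)
  have h3 : (ε * u a n) ^ 2 ≤ (u a n - (⌊(1 - ε) * u a n⌋₊ : ℕ)) ^ 2 :=
    pow_le_pow_left₀ (by positivity) (by linarith) 2
  have h4 : (1 - s a n ⌊(1 - ε) * u a n⌋₊) * (ε * u a n) ^ 2 ≤ u a n / l a n :=
    (mul_le_mul_of_nonneg_left h3 (by linarith [P.s_le_one a n ⌊(1 - ε) * u a n⌋₊])).trans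
      (h2.trans (by linarith [hn.var_le]))
  rw [← mul_inv, sub_le_comm, ← one_div, le_div_iff₀ (by positivity)]
  rw [le_div_iff₀ hl] at h4
  refine le_of_mul_le_mul_right ?_ hu
  nlinarith

lemma tendsto_surv_zero (P : CutoffProfile δ er d s u v l) {a : ℝ} (ha : a ∈ Set.Ioo (0 : ℝ) 1)
    (h : Tendsto (fun n => u a n * l a n) atTop atTop) {ε : ℝ} (hε : ε ∈ Set.Ioo (0 : ℝ) 1) :
    Tendsto (fun n => s a n ⌊(1 + ε) * u a n⌋₊) atTop (nhds 0) := by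
  have h1 : Tendsto (fun n => (ε ^ 2)⁻¹ * (u a n * l a n)⁻¹) atTop (nhds 0) := by
    simpa using h.inv_tendsto_atTop.const_mul ((ε ^ 2)⁻¹)
  refine tendsto_of_tendsto_of_tendsto_of_le_of_le' tendsto_const_nhds h1
    (Eventually.of_forall fun n => P.s_nonneg _ _ _) ?_
  filter_upwards [P.bounds a ha] with n hn
  have hu : 0 < u a n := by linarith [hn.one_le]
  have hl := hn.l_pos
  have e0 := hε.1
  have hm := Nat.lt_floor_add_one ((1 + ε) * u a n)
  have h2 := hn.upper ⌊(1 + ε) * u a n⌋₊ (by nlinarith)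
  have h3 : (ε * u a n) ^ 2 ≤ ((⌊(1 + ε) * u a n⌋₊ : ℕ) + 1 - u a n) ^ 2 :=
    pow_le_pow_left₀ (by positivity) (by linarith) 2
  have h4 : s a n ⌊(1 + ε) * u a n⌋₊ * (ε * u a n) ^ 2 ≤ u a n / l a n :=
    (mul_le_mul_of_nonneg_left h3 (P.s_nonneg _ _ _)).trans (h2.trans (by linarith [hn.var_le]))
  rw [← mul_inv, ← one_div, le_div_iff₀ (by positivity)]
  rw [le_div_iff₀ hl] at h4
  refine le_of_mul_le_mul_right ?_ hu
  nlinarith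

lemma tendsto_mean_div_of_lt (P : CutoffProfile δ er d s u v l) {a b : ℝ}
    (ha : a ∈ Set.Ioo (0 : ℝ) 1) (hb : b ∈ Set.Ioo (0 : ℝ) 1) (hab : a < b)
    (h : Tendsto (fun n => u b n * l b n) atTop atTop) :
    Tendsto (fun n => u a n / u b n) atTop (nhds 1) := by
  have h1 : Tendsto (fun n => 1 - a⁻¹ * (u b n * l b n)⁻¹) atTop (nhds 1) := by
    simpa using (h.inv_tendsto_atTop.const_mul a⁻¹).const_sub 1
  have ha0 := ha.1
  refine tendsto_of_tendsto_of_tendsto_of_le_of_le' h1 tendsto_const_nhds ?_ ?_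
  · filter_upwards [P.bounds b hb, P.mono a ha b hb hab] with n hn hm
    have hu : 0 < u b n := by linarith [hn.one_le]
    have hl := hn.l_pos
    have h2 := hm.mean_le_add
    rw [le_div_iff₀ hu, sub_mul, one_mul, sub_le_iff_le_add]
    refine h2.trans (le_of_eq ?_)
    field_simp
  · filter_upwards [P.bounds b hb, P.mono a ha b hb hab] with n hn hm
    exact (div_le_one (by linarith [hn.one_le])).mpr hm.mean_le

lemma tendsto_mean_div (P : CutoffProfile δ er d s u v l) {a b : ℝ}
    (ha : a ∈ Set.Ioo (0 : ℝ) 1) (hb : b ∈ Set.Ioo (0 : ℝ) 1)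
    (h : ∀ a ∈ Set.Ioo (0 : ℝ) 1, Tendsto (fun n => u a n * l a n) atTop atTop) :
    Tendsto (fun n => u a n / u b n) atTop (nhds 1) := by
  rcases lt_trichotomy a b with hab | rfl | hab
  · exact P.tendsto_mean_div_of_lt ha hb hab (h b hb)
  · refine tendsto_const_nhds.congr' ?_
    filter_upwards [P.bounds a ha] with n hn
    rw [div_self (by linarith [hn.one_le])]
  · simpa using (P.tendsto_mean_div_of_lt hb ha hab (h a ha)).inv₀ one_ne_zero

lemma tendsto_floor_sub_atTop {t : ℕ → ℝ} (ht : Tendsto t atTop atTop) {x y : ℝ} (hx : 0 ≤ x)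
    (hxy : x < y) : Tendsto (fun n => ⌊y * t n⌋₊ - ⌊x * t n⌋₊) atTop atTop := by
  have h1 : Tendsto (fun n => (y - x) * t n - 1) atTop atTop :=
    tendsto_atTop_add_const_right _ _ (ht.const_mul_atTop (by linarith))
  rw [← tendsto_natCast_atTop_iff (R := ℝ)]
  refine tendsto_atTop_mono' _ ?_ h1
  filter_upwards [ht.eventually_ge_atTop 0] with n hn
  have h2 : ⌊x * t n⌋₊ ≤ ⌊y * t n⌋₊ := Nat.floor_le_floor (mul_le_mul_of_nonneg_right hxy.le hn)
  rw [Nat.cast_sub h2]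
  have h3 := Nat.floor_le (mul_nonneg hx hn)
  have h4 := Nat.lt_floor_add_one (y * t n)
  linarith

lemma sharpTransition_mean (P : CutoffProfile δ er d s u v l)
    (h : ∀ a ∈ Set.Ioo (0 : ℝ) 1, Tendsto (fun n => u a n * l a n) atTop atTop) {a : ℝ}
    (ha : a ∈ Set.Ioo (0 : ℝ) 1) : SharpTransition d (u a) := by
  have htop := P.tendsto_mean ha (h a ha)
  intro ε hε
  obtain ⟨e0, e1⟩ := hε
  constructor
  · rw [Metric.tendsto_nhds]
    intro η hη
    set b := 1 - min (η / 4) (1 / 2) with hb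
    have hm1 : min (η / 4) (1 / 2) ≤ η / 4 := min_le_left _ _
    have hm2 : min (η / 4) (1 / 2) ≤ (1 : ℝ) / 2 := min_le_right _ _
    have hm3 : 0 < min (η / 4) (1 / 2) := lt_min (by positivity) (by norm_num)
    have hb' : b ∈ Set.Ioo (0 : ℝ) 1 := ⟨by linarith, by linarith⟩
    have hs := P.tendsto_surv_zero hb' (h b hb') (ε := ε / 4) ⟨by linarith, by linarith⟩
    have hr := P.er_tendsto.comp
      (tendsto_floor_sub_atTop htop (x := 1 + ε / 2) (y := 1 + ε) (by linarith) (by linarith))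
    filter_upwards [hs.eventually (gt_mem_nhds (by positivity : (0 : ℝ) < η / 4)),
      hr.eventually (gt_mem_nhds (by positivity : (0 : ℝ) < η / 4)),
      (P.tendsto_mean_div ha hb' h).eventually
        (lt_mem_nhds (by linarith : 1 - ε / 8 < 1)), P.bounds b hb',
      htop.eventually_ge_atTop 0] with n h1 h2 h3 h4 h5
    have hub : 0 < u b n := by linarith [h4.one_le]
    rw [lt_div_iff₀ hub] at h3
    have h6 : s b n ⌊(1 + ε / 2) * u a n⌋₊ ≤ s b n ⌊(1 + ε / 4) * u b n⌋₊ :=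
      P.s_anti b n (Nat.floor_le_floor (by
        nlinarith [mul_lt_mul_of_pos_left h3 (by linarith : 0 < 1 + ε / 2),
          mul_nonneg (mul_nonneg e0.le (sub_nonneg.mpr e1.le)) hub.le, mul_pos e0 hub]))
    have h7 := P.d_add_le b hb' n ⌊(1 + ε / 2) * u a n⌋₊
      (⌊(1 + ε) * u a n⌋₊ - ⌊(1 + ε / 2) * u a n⌋₊)
    rw [Nat.add_sub_cancel' (Nat.floor_le_floor (by nlinarith))] at h7
    simp only [Function.comp] at h2
    rw [Real.dist_eq, sub_zero, abs_of_nonneg (P.d_nonneg _ _)]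
    have h8 := P.s_nonneg b n ⌊(1 + ε / 2) * u a n⌋₊
    nlinarith [hb'.2, hb'.1]
  · rw [Metric.tendsto_nhds]
    intro η hη
    set b := min (η / 4) (1 / 2) with hb
    have hm1 : b ≤ η / 4 := min_le_left _ _
    have hm2 : b ≤ (1 : ℝ) / 2 := min_le_right _ _
    have hm3 : 0 < b := lt_min (by positivity) (by norm_num)
    have hb' : b ∈ Set.Ioo (0 : ℝ) 1 := ⟨by linarith, by linarith⟩
    have hs := P.tendsto_surv_one hb' (h b hb') (ε := ε / 2) ⟨by linarith, by linarith⟩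
    filter_upwards [hs.eventually (lt_mem_nhds (by linarith : 1 - η / 4 < 1)),
      (P.tendsto_mean_div ha hb' h).eventually
        (gt_mem_nhds (by linarith : 1 < 1 + ε / 2)), P.bounds b hb'] with n h1 h2 h4
    have hub : 0 < u b n := by linarith [h4.one_le]
    rw [div_lt_iff₀ hub] at h2
    have h6 : s b n ⌊(1 - ε / 2) * u b n⌋₊ ≤ s b n ⌊(1 - ε) * u a n⌋₊ :=
      P.s_anti b n (Nat.floor_le_floor (by nlinarith [mul_pos e0 hub, mul_pos (mul_pos e0 e0) hub]))
    have h7 := P.s_le_d b hb' n ⌊(1 - ε) * u a n⌋₊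
    rw [Real.dist_eq, abs_sub_comm,
      abs_of_nonneg (by linarith [P.d_le_one n ⌊(1 - ε) * u a n⌋₊])]
    linarith

lemma tendsto_time_of_sharpTransition (P : CutoffProfile δ er d s u v l) {t : ℕ → ℝ}
    (ht : SharpTransition d t) {a : ℝ} (ha : a ∈ Set.Ioo (0 : ℝ) 1)
    (hu : Tendsto (u a) atTop atTop) : Tendsto t atTop atTop := by
  rw [tendsto_atTop]
  intro B
  have h1 := (ht (1 / 2) ⟨by norm_num, by norm_num⟩).1
  set m0 := ⌊(1 + 1 / 2) * B⌋₊ with hm0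
  have e : 0 < (1 - a) / 2 := by linarith [ha.2]
  filter_upwards [h1.eventually (gt_mem_nhds e), P.bounds a ha,
    hu.eventually_gt_atTop ((m0 : ℝ) / ((1 - a) / 2))] with n h2 h3 h4
  by_contra! hlt
  have h5 : d n m0 ≤ d n ⌊(1 + 1 / 2) * t n⌋₊ :=
    P.d_anti n (Nat.floor_le_floor (by linarith))
  have h6 := P.s_le_d a ha n m0
  have h7 := h3.mul_le m0
  rw [div_lt_iff₀ e] at h4
  nlinarith [h3.one_le]

lemma tendsto_surv_of_sharpTransition (P : CutoffProfile δ er d s u v l) {t : ℕ → ℝ}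
    (ht : SharpTransition d t) (htop : Tendsto t atTop atTop) {b : ℝ}
    (hb : b ∈ Set.Ioo (0 : ℝ) 1) {ε : ℝ} (hε : ε ∈ Set.Ioo (0 : ℝ) 1) :
    Tendsto (fun n => s b n ⌊(1 - ε) * t n⌋₊) atTop (nhds 1) := by
  obtain ⟨e0, e1⟩ := hε
  have hr := P.er_tendsto.comp
    (tendsto_floor_sub_atTop htop (x := 1 - ε) (y := 1 - ε / 2) (by linarith) (by linarith))
  have hd := (ht (ε / 2) ⟨by linarith, by linarith⟩).2
  have h1 : Tendsto (fun n => 1 - b⁻¹ * (1 - d n ⌊(1 - ε / 2) * t n⌋₊ +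
      (er ∘ fun n => ⌊(1 - ε / 2) * t n⌋₊ - ⌊(1 - ε) * t n⌋₊) n)) atTop (nhds 1) := by
    simpa using (((hd.const_sub 1).add hr).const_mul b⁻¹).const_sub 1
  refine tendsto_of_tendsto_of_tendsto_of_le_of_le' h1 tendsto_const_nhds ?_
    (Eventually.of_forall fun n => P.s_le_one _ _ _)
  filter_upwards [htop.eventually_ge_atTop 0] with n hn
  have h7 := P.d_add_le b hb n ⌊(1 - ε) * t n⌋₊ (⌊(1 - ε / 2) * t n⌋₊ - ⌊(1 - ε) * t n⌋₊)
  rw [Nat.add_sub_cancel' (Nat.floor_le_floor (by nlinarith))] at h7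
  rw [sub_le_comm, ← div_eq_inv_mul, le_div_iff₀ hb.1]
  simp only [Function.comp]
  linarith

lemma time_le_mean_of_sharpTransition (P : CutoffProfile δ er d s u v l) {t : ℕ → ℝ}
    (ht : SharpTransition d t) (htop : Tendsto t atTop atTop) {b : ℝ}
    (hb : b ∈ Set.Ioo (0 : ℝ) 1) : ∀ᶠ n in atTop, t n ≤ 8 * u b n := by
  have h1 := P.tendsto_surv_of_sharpTransition ht htop hb (ε := 1 / 2)
    ⟨by norm_num, by norm_num⟩
  filter_upwards [h1.eventually (lt_mem_nhds (by norm_num : (1 : ℝ) / 2 < 1)),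
    P.bounds b hb, htop.eventually_ge_atTop 4] with n h2 h3 h4
  have h5 := h3.le_mul ⌊(1 - 1 / 2) * t n⌋₊
  have h6 := Nat.lt_floor_add_one ((1 - 1 / 2) * t n)
  have h7 := mul_nonneg (Nat.cast_nonneg (α := ℝ) ⌊(1 - 1 / 2) * t n⌋₊) (sub_nonneg.mpr h2.le)
  linarith

lemma limsup_surv_le_of_sharpTransition (P : CutoffProfile δ er d s u v l) {t : ℕ → ℝ}
    (ht : SharpTransition d t) (ht0 : ∀ n, 0 < t n) {b : ℝ} (hb : b ∈ Set.Ioo (0 : ℝ) 1) {ε : ℝ}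
    (hε : 0 < ε) : limsup (fun n => s b n ⌊(1 + ε) * t n⌋₊) atTop ≤ b := by
  set ε' := min ε (1 / 2) with hε'
  have e1 : ε' ≤ ε := min_le_left _ _
  have e2 : ε' ∈ Set.Ioo (0 : ℝ) 1 :=
    ⟨lt_min hε (by norm_num), (min_le_right _ _).trans_lt (by norm_num)⟩
  have h1 : Tendsto (fun n => d n ⌊(1 + ε') * t n⌋₊ + b) atTop (nhds b) := by
    simpa using (ht ε' e2).1.add_const b
  refine (limsup_le_limsup (v := fun n => d n ⌊(1 + ε') * t n⌋₊ + b)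
    (Eventually.of_forall fun n => ?_) ?_ ?_).trans_eq
    h1.limsup_eq
  · have h2 := P.d_anti n (Nat.floor_le_floor
      (mul_le_mul_of_nonneg_right (by linarith : 1 + ε' ≤ 1 + ε) (ht0 n).le))
    have h3 := P.s_le_d b hb n ⌊(1 + ε) * t n⌋₊
    dsimp only
    linarith
  · exact IsCoboundedUnder.of_frequently_ge (a := 0) (Frequently.of_forall fun n => P.s_nonneg _ _ _)
  · exact h1.isBoundedUnder_le

lemma eventually_surv_le_of_limsup (P : CutoffProfile δ er d s u v l) {t : ℕ → ℝ} {b : ℝ}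
    (h : ∃ α ∈ Set.Ioo (0 : ℝ) 1, ∀ ε > (0 : ℝ),
      limsup (fun n => s b n ⌊(1 + ε) * t n⌋₊) atTop ≤ α) :
    ∃ α ∈ Set.Ioo (0 : ℝ) 1, ∀ ε > (0 : ℝ), ∀ᶠ n in atTop, s b n ⌊(1 + ε) * t n⌋₊ ≤ α := by
  obtain ⟨α, ⟨h0, h1⟩, h2⟩ := h
  refine ⟨(α + 1) / 2, ⟨by linarith, by linarith⟩, fun ε hε => ?_⟩
  have h3 := eventually_lt_of_limsup_lt ((h2 ε hε).trans_lt (by linarith : α < (α + 1) / 2))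
    (isBoundedUnder_of ⟨1, fun n => P.s_le_one _ _ _⟩)
  exact h3.mono fun n hn => hn.le

lemma tendsto_time_of_surv_le (P : CutoffProfile δ er d s u v l) {t : ℕ → ℝ} {b α : ℝ}
    (hb : b ∈ Set.Ioo (0 : ℝ) 1) (ht0 : ∀ n, 0 < t n) (hu : Tendsto (u b) atTop atTop)
    (hα : α < 1) (h : ∀ ε > (0 : ℝ), ∀ᶠ n in atTop, s b n ⌊(1 + ε) * t n⌋₊ ≤ α) :
    Tendsto t atTop atTop := by
  refine tendsto_atTop_mono' _ ?_ (hu.const_mul_atTop (by linarith : 0 < (1 - α) / 2))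
  filter_upwards [h 1 one_pos, P.bounds b hb] with n h1 h2
  have h3 := h2.mul_le ⌊(1 + 1) * t n⌋₊
  have h4 := Nat.floor_le (by linarith [ht0 n] : 0 ≤ (1 + 1) * t n)
  nlinarith [h2.one_le]

lemma tendsto_time_mul_eig (P : CutoffProfile δ er d s u v l) {t : ℕ → ℝ} {b α : ℝ}
    (hb : b ∈ Set.Ioo (0 : ℝ) 1) (htop : Tendsto t atTop atTop) (hα : α < 1)
    (h1 : ∀ ε ∈ Set.Ioo (0 : ℝ) 1, Tendsto (fun n => s b n ⌊(1 - ε) * t n⌋₊) atTop (nhds 1))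
    (h2 : ∀ ε > (0 : ℝ), ∀ᶠ n in atTop, s b n ⌊(1 + ε) * t n⌋₊ ≤ α) :
    Tendsto (fun n => t n * l b n) atTop atTop := by
  rw [tendsto_atTop]
  intro L₀
  set L := max L₀ 1 with hL
  have hL1 : 1 ≤ L := le_max_right _ _
  obtain ⟨ε, e0, e1, e2⟩ : ∃ ε : ℝ, 0 < ε ∧ ε ≤ 1 / 4 ∧ 4 * ε * L < 1 - α := by
    refine ⟨min (1 / 4) ((1 - α) / (8 * L)), lt_min (by norm_num)
      (div_pos (by linarith) (by linarith)), min_le_left _ _, ?_⟩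
    have h3 := min_le_right (1 / 4) ((1 - α) / (8 * L))
    rw [le_div_iff₀ (by linarith)] at h3
    linarith
  have hinv : Tendsto (fun n => (t n)⁻¹) atTop (nhds 0) := htop.inv_tendsto_atTop
  have hA : Tendsto (fun n => s b n ⌊(1 - ε) * t n⌋₊ - 2 / ε ^ 2 * (t n)⁻¹) atTop (nhds 1) := by
    simpa using (h1 ε ⟨e0, by linarith⟩).sub (hinv.const_mul (2 / ε ^ 2))
  have hB : Tendsto (fun n => (1 - 4 * ε * L - L * (t n)⁻¹)) atTop (nhds (1 - 4 * ε * L)) := by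
    simpa using (hinv.const_mul L).const_sub (1 - 4 * ε * L)
  have hC : Tendsto (fun n => (1 - 4 * ε * L - L * (t n)⁻¹) *
      (s b n ⌊(1 - ε) * t n⌋₊ - 2 / ε ^ 2 * (t n)⁻¹) - 1 / ε ^ 2 * (t n)⁻¹) atTop
      (nhds (1 - 4 * ε * L)) := by
    have h3 := (hB.mul hA).sub (hinv.const_mul (1 / ε ^ 2))
    rwa [mul_one, mul_zero, sub_zero] at h3
  filter_upwards [P.bounds b hb, h2 ε e0, htop.eventually_ge_atTop (2 / ε),
    hA.eventually (lt_mem_nhds one_pos),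
    hC.eventually (lt_mem_nhds (by linarith : α < 1 - 4 * ε * L))] with n hn h3 h4 h5 h6
  by_contra! hlt
  have ht : 2 ≤ ε * t n := by rw [div_le_iff₀ e0] at h4; linarith
  linarith [hn.compare_floor P.δ_pos e0 e1 ht (hlt.trans_le (le_max_left _ _) : t n * l b n < L) h5.le]

lemma eig_of_surv (P : CutoffProfile δ er d s u v l) {t : ℕ → ℝ} (ht0 : ∀ n, 0 < t n) {a₀ a : ℝ}
    (ha₀ : a₀ ∈ Set.Ioo (0 : ℝ) 1) (hu : Tendsto (u a₀) atTop atTop) (ha : a ∈ Set.Ioo (0 : ℝ) 1)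
    (hO : ∀ c ∈ Set.Ioo (0 : ℝ) 1, ∃ C : ℝ, ∀ᶠ n in atTop, t n ≤ C * u c n)
    (h1 : ∀ ε ∈ Set.Ioo (0 : ℝ) 1, Tendsto (fun n => s a n ⌊(1 - ε) * t n⌋₊) atTop (nhds 1))
    (h2 : ∀ b ∈ Set.Ioo a 1, ∃ α ∈ Set.Ioo (0 : ℝ) 1, ∀ ε > (0 : ℝ),
      limsup (fun n => s b n ⌊(1 + ε) * t n⌋₊) atTop ≤ α) :
    (∀ c ∈ Set.Ioo (0 : ℝ) 1, Tendsto (fun n => u c n * l c n) atTop atTop) ∧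
      ∃ b ∈ Set.Ioo (0 : ℝ) 1, Tendsto (fun n => u b n / t n) atTop (nhds 1) := by
  have hup : ∀ b ∈ Set.Ioo a 1, ∀ ε ∈ Set.Ioo (0 : ℝ) 1,
      Tendsto (fun n => s b n ⌊(1 - ε) * t n⌋₊) atTop (nhds 1) := fun b hb ε hε => by
    refine tendsto_of_tendsto_of_tendsto_of_le_of_le' (h1 ε hε) tendsto_const_nhds ?_
      (Eventually.of_forall fun n => P.s_le_one _ _ _)
    filter_upwards [P.mono a ha b ⟨ha.1.trans hb.1, hb.2⟩ hb.1] with n hn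
    exact hn.surv_le _
  have htop : Tendsto t atTop atTop := by
    set b := (max a a₀ + 1) / 2 with hb
    have hm : max a a₀ < 1 := max_lt ha.2 ha₀.2
    have hba : a < b := by linarith [le_max_left a a₀]
    have hba₀ : a₀ < b := by linarith [le_max_right a a₀]
    have hb1 : b < 1 := by linarith
    have hb' : b ∈ Set.Ioo (0 : ℝ) 1 := ⟨ha.1.trans hba, hb1⟩
    obtain ⟨α, hα, h3⟩ := P.eventually_surv_le_of_limsup (h2 b ⟨hba, hb1⟩)
    refine P.tendsto_time_of_surv_le hb' ht0 (tendsto_atTop_mono' _ ?_ hu) hα.2 h3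
    filter_upwards [P.mono a₀ ha₀ b hb' hba₀] with n hn
    exact hn.mean_le
  have heig : ∀ b ∈ Set.Ioo a 1, Tendsto (fun n => t n * l b n) atTop atTop := fun b hb => by
    obtain ⟨α, hα, h3⟩ := P.eventually_surv_le_of_limsup (h2 b hb)
    exact P.tendsto_time_mul_eig ⟨ha.1.trans hb.1, hb.2⟩ htop hα.2 (hup b hb) h3
  have h3 : ∀ c ∈ Set.Ioo (0 : ℝ) 1, Tendsto (fun n => u c n * l c n) atTop atTop := by
    intro c hc
    set b := (max a c + 1) / 2 with hb
    have hm : max a c < 1 := max_lt ha.2 hc.2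
    have hba : a < b := by linarith [le_max_left a c]
    have hbc : c < b := by linarith [le_max_right a c]
    have hb1 : b < 1 := by linarith
    have hb' : b ∈ Set.Ioo (0 : ℝ) 1 := ⟨ha.1.trans hba, hb1⟩
    obtain ⟨C, hC⟩ := hO c hc
    set C' := max C 1 with hC'
    have hC1 : 1 ≤ C' := le_max_right _ _
    refine tendsto_atTop_mono' _ ?_
      ((heig b ⟨hba, hb1⟩).const_mul_atTop (inv_pos.mpr (by linarith : 0 < C')))
    filter_upwards [hC, P.bounds b hb', P.bounds c hc, P.mono c hc b hb' hbc] with n h4 h5 h6 h7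
    have hu0 : 0 < u c n := by linarith [h6.one_le]
    have h8 : t n ≤ C' * u c n :=
      h4.trans (mul_le_mul_of_nonneg_right (le_max_left _ _) hu0.le)
    rw [← div_eq_inv_mul, div_le_iff₀ (by linarith)]
    calc t n * l b n ≤ (C' * u c n) * l c n :=
          mul_le_mul h8 h7.eig_le h5.l_pos.le (mul_nonneg (by linarith) hu0.le)
      _ = _ := by ring
  refine ⟨h3, ?_⟩
  set b := (a + 1) / 2 with hb
  have hba : b ∈ Set.Ioo a 1 := ⟨by linarith [ha.2], by linarith [ha.2]⟩
  have hb' : b ∈ Set.Ioo (0 : ℝ) 1 := ⟨ha.1.trans hba.1, hba.2⟩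
  obtain ⟨α, hα, h4⟩ := P.eventually_surv_le_of_limsup (h2 b hba)
  refine ⟨b, hb', tendsto_div_nhds_one_of_forall (Eventually.of_forall ht0) (fun ε hε => ?_)
    (fun ε hε => ?_)⟩
  · filter_upwards [h4 ε hε.1,
      (P.tendsto_surv_one hb' (h3 b hb') hε).eventually (lt_mem_nhds hα.2)] with n h5 h6
    by_contra! hlt
    linarith [P.s_anti b n (Nat.floor_le_floor hlt.le)]
  · filter_upwards [(hup b hba ε hε).eventually (lt_mem_nhds (by norm_num : (1 : ℝ) / 2 < 1)),
      (P.tendsto_surv_zero hb' (h3 b hb') hε).eventually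
        (gt_mem_nhds (by norm_num : (0 : ℝ) < 1 / 2))] with n h5 h6
    by_contra! hlt
    linarith [P.s_anti b n (Nat.floor_le_floor hlt.le)]

lemma cutoffWith_mean (P : CutoffProfile δ er d s u v l)
    (h : ∀ a ∈ Set.Ioo (0 : ℝ) 1, Tendsto (fun n => u a n * l a n) atTop atTop) {a : ℝ}
    (ha : a ∈ Set.Ioo (0 : ℝ) 1) :
    cutoffWith (fun ε n => ((mixD (d n) ε : ℕ) : ℝ)) (u a) :=
  (P.cutoffWith_iff ((P.tendsto_mean ha (h a ha)).eventually_gt_atTop 0)).mpr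
    (P.sharpTransition_mean h ha)

lemma hasCutoff_of_eig (P : CutoffProfile δ er d s u v l)
    (h : ∀ a ∈ Set.Ioo (0 : ℝ) 1, Tendsto (fun n => u a n * l a n) atTop atTop) :
    hasCutoff (fun ε n => ((mixD (d n) ε : ℕ) : ℝ)) := by
  have ha : (1 / 2 : ℝ) ∈ Set.Ioo (0 : ℝ) 1 := ⟨by norm_num, by norm_num⟩
  refine ⟨fun n => if 0 < u (1 / 2) n then u (1 / 2) n else 1, fun n => ?_, fun ε hε => ?_⟩
  · dsimp only
    split_ifs with h1
    · exact h1
    · exact one_pos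
  · refine (P.cutoffWith_mean h ha ε hε).congr' ?_
    filter_upwards [(P.tendsto_mean ha (h _ ha)).eventually_gt_atTop 0] with n hn
    rw [if_pos hn]

lemma cutoffWith_of_surv (P : CutoffProfile δ er d s u v l) {t : ℕ → ℝ} (ht0 : ∀ n, 0 < t n)
    {a₀ a : ℝ} (ha₀ : a₀ ∈ Set.Ioo (0 : ℝ) 1) (hu : Tendsto (u a₀) atTop atTop)
    (ha : a ∈ Set.Ioo (0 : ℝ) 1)
    (hO : ∀ c ∈ Set.Ioo (0 : ℝ) 1, ∃ C : ℝ, ∀ᶠ n in atTop, t n ≤ C * u c n)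
    (h1 : ∀ ε ∈ Set.Ioo (0 : ℝ) 1, Tendsto (fun n => s a n ⌊(1 - ε) * t n⌋₊) atTop (nhds 1))
    (h2 : ∀ b ∈ Set.Ioo a 1, ∃ α ∈ Set.Ioo (0 : ℝ) 1, ∀ ε > (0 : ℝ),
      limsup (fun n => s b n ⌊(1 + ε) * t n⌋₊) atTop ≤ α) :
    cutoffWith (fun ε n => ((mixD (d n) ε : ℕ) : ℝ)) t := by
  obtain ⟨h3, b, hb, h4⟩ := P.eig_of_surv ht0 ha₀ hu ha hO h1 h2
  intro ε hε
  have h5 := (P.cutoffWith_mean h3 hb ε hε).mul h4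
  rw [one_mul] at h5
  refine h5.congr' ?_
  filter_upwards [P.bounds b hb] with n hn
  rw [div_mul_div_cancel₀ (by linarith [hn.one_le])]

end CutoffProfile

namespace BDChain

variable {n : ℕ} (c : BDChain n)

lemma piLow_zero : c.piLow 0 = c.pi 0 := by
  simp only [piLow, Fin.le_zero_iff]
  simp

lemma le_of_quantile {a b : ℝ} {M M' : Fin (n + 1)} (hab : a < b) (h : 1 - a ≤ c.piHigh M)
    (h' : b ≤ c.piLow M') : M ≤ M' := by
  by_contra! hlt
  have h1 := c.sum_lt_add_piHigh M
  have h2 : c.piLow M' ≤ ∑ y with y < M, c.pi y := by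
    rw [piLow, Finset.sum_filter]
    refine Finset.sum_le_sum fun y _ => ?_
    have hy := c.pi_pos y
    split_ifs with h3 h4 h4
    · exact le_rfl
    · exact absurd (h3.trans_lt hlt) h4
    · exact hy.le
    · exact le_rfl
  linarith

lemma hitBounds {δ : ℝ} (hδ : ∀ x, δ ≤ c.K x x) {M : Fin (n + 1)} (hM : 0 < M) {l : ℝ}
    (hl : IsSmallestEig (c.subIK M) l) :
    HitBounds δ (c.hitSurv M 0) (c.hitMean M 0) (c.hitVar M 0) l := by
  have hM' : 0 < (M : ℕ) := hM
  have : NeZero (M : ℕ) := ⟨hM'.ne'⟩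
  have h0 : (⟨((0 : Fin (n + 1)) : ℕ), hM⟩ : Fin (M : ℕ)) = 0 := Fin.ext (by simp)
  have hs : ∀ m, c.hitSurv M 0 m = (c.sub M).surv m 0 := fun m => by
    rw [c.hitSurv_eq_surv hM, h0]
  have hu : c.hitMean M 0 = (c.sub M).mean 0 := by rw [c.hitMean_eq_mean hM, h0]
  have hv : c.hitVar M 0 = (c.sub M).mom2 0 - (c.sub M).mean 0 ^ 2 := by
    rw [c.hitVar_eq hM, h0]
  rw [c.subIK_eq] at hl
  have n0 := c.hitSurv_nonneg M 0
  have n1 := c.hitSurv_le_one (Fin.zero_le M)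
  have na := c.hitSurv_antitone (Fin.zero_le M)
  have ns := c.hitSurv_summable (Fin.zero_le M)
  have n2 := c.hitSurv_summable_two (Fin.zero_le M)
  refine ⟨fun m => ?_, fun m => nat_mul_le_tsum n0 na ns m, fun m hm => ?_, fun m hm => ?_,
    (c.sub M).eig_pos hl, ?_, ?_, ?_, ?_, fun j j' k k' h1 h2 h3 => ?_⟩
  · refine tsum_mul_le n1 ns m fun k => ?_
    rw [hs, hs, hs]
    exact (c.sub M).surv_add_le k m 0
  · exact lower_tail_le n0 n1 na ns n2 m hm
  · exact upper_tail_le n0 n1 na ns n2 m hm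
  · rw [hu]; exact (c.sub M).one_le_mean 0
  · rw [hu, hv]
    exact (c.sub M).mean_lt_var (fun x => by rw [c.sub_Q]; exact hδ _) 0
  · rw [hu, hv]; exact (c.sub M).inv_eig_sq_le hl
  · rw [hu, hv]; exact (c.sub M).var_add_mean_le hl
  · rw [hs, hs]; exact (c.sub M).surv_compare hl h1 h2 h3

lemma hitMono {a : ℝ} (ha : 0 < a) {M M' : Fin (n + 1)} (hM : 0 < M) (hMM : M ≤ M')
    (hlow : a ≤ c.piLow M) {l l' : ℝ} (hl : IsSmallestEig (c.subIK M) l)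
    (hl' : IsSmallestEig (c.subIK M') l') (hpos : 0 < l') :
    HitMono a (c.hitSurv M 0) (c.hitSurv M' 0) (c.hitMean M 0) (c.hitMean M' 0) l l' := by
  refine ⟨c.hitSurv_mono hMM (Fin.zero_le M), c.hitMean_mono hMM (Fin.zero_le M), ?_,
    c.eig_anti hMM hl hl'⟩
  rcases hMM.eq_or_lt with rfl | hlt
  · have : 0 ≤ 1 / (a * l') := by positivity
    linarith
  · refine (c.hitMean_le_add hMM hM).trans ?_
    gcongr
    have h1 := c.hitMean_mul_piLow_le hlt hl'
    have h2 : c.hitMean M' M * a ≤ 1 / l' :=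
      (mul_le_mul_of_nonneg_left hlow (c.hitMean_nonneg M' M)).trans h1
    rw [mul_comm a, ← div_div, le_div_iff₀ ha]
    exact h2

end BDChain

lemma cutoffProfile_of_quantiles (F : (n : ℕ) → BDChain n)
    (M : ℝ → (n : ℕ) → Fin (n + 1))
    (hM : ∀ a ∈ Set.Ioo (0 : ℝ) 1, ∀ n,
      a ≤ (F n).piLow (M a n) ∧ 1 - a ≤ (F n).piHigh (M a n))
    (lam : ℝ → ℕ → ℝ)
    (hlam : ∀ a ∈ Set.Ioo (0 : ℝ) 1, ∀ n, 0 < ((M a n : ℕ)) →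
      IsSmallestEig ((F n).subIK (M a n)) (lam a n))
    (hπ0 : Tendsto (fun n => (F n).pi 0) atTop (nhds 0)) {δ : ℝ} (hδ0 : 0 < δ) (hδ1 : δ < 1)
    (hδ : ∀ n, ∀ i : Fin (n + 1), δ ≤ (F n).K i i) :
    CutoffProfile δ (fun r => 1 / Real.sqrt (((r + 1 : ℕ) : ℝ) * (1 - δ) * δ))
      (fun n => (F n).dTV 0) (fun a n => (F n).hitSurv (M a n) 0)
      (fun a n => (F n).hitMean (M a n) 0) (fun a n => (F n).hitVar (M a n) 0) lam := by
  have hpos : ∀ a ∈ Set.Ioo (0 : ℝ) 1, ∀ᶠ n in atTop, 0 < M a n := fun a ha => by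
    filter_upwards [hπ0.eventually (gt_mem_nhds ha.1)] with n hn
    rw [Fin.pos_iff_ne_zero]
    intro h
    have h1 := (hM a ha n).1
    rw [h, BDChain.piLow_zero] at h1
    linarith
  have hb : ∀ a ∈ Set.Ioo (0 : ℝ) 1, ∀ᶠ n in atTop, HitBounds δ ((F n).hitSurv (M a n) 0)
      ((F n).hitMean (M a n) 0) ((F n).hitVar (M a n) 0) (lam a n) := fun a ha => by
    filter_upwards [hpos a ha] with n hn
    exact (F n).hitBounds (hδ n) hn (hlam a ha n hn)
  refine ⟨hδ0, BDChain.tendsto_sqrt_bound hδ0 hδ1, fun n => (F n).dTV_antitone 0,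
    fun n => (F n).dTV_nonneg 0, fun n => (F n).dTV_le_one 0,
    fun n => (F n).tendsto_dTV hδ0 hδ1 (hδ n),
    fun a n => (F n).hitSurv_antitone (Fin.zero_le _), fun a n => (F n).hitSurv_nonneg _ _,
    fun a n => (F n).hitSurv_le_one (Fin.zero_le _), fun a ha n m r => ?_, fun a ha n m => ?_,
    hb, fun a ha b hb' hab => ?_⟩
  · refine ((F n).dTV_add_le hδ0 hδ1 (hδ n) (M a n) m r).trans ?_
    have h1 := mul_le_mul_of_nonneg_left (hM a ha n).1
      (sub_nonneg.mpr ((F n).hitSurv_le_one (Fin.zero_le (M a n)) m))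
    linarith
  · linarith [(F n).hitSurv_le_dTV (M a n) m, (hM a ha n).2]
  · filter_upwards [hpos a ha, hpos b hb', hb b hb'] with n h1 h2 h3
    exact (F n).hitMono ha.1 h1 ((F n).le_of_quantile hab (hM a ha n).2 (hM b hb' n).1)
      (hM a ha n).1 (hlam a ha n h1) (hlam b hb' n h2) h3.l_pos

/-- Theorem `t-tv4`.  Discrete-time version of the characterization of the
total variation cutoff for birth and death chains started at the left boundary state,
assuming `π_n(0) → 0`, `inf_{i,n} K_n(i,i) > 0` and `u_n(a) → ∞` for some `a ∈ (0,1)`. -/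
theorem birth_death_left_TV_cutoff_characterization_discrete
    (F : (n : ℕ) → BDChain n)
    (M : ℝ → (n : ℕ) → Fin (n + 1))
    (hM : ∀ a ∈ Set.Ioo (0 : ℝ) 1, ∀ n,
      a ≤ (F n).piLow (M a n) ∧ 1 - a ≤ (F n).piHigh (M a n))
    (lam : ℝ → ℕ → ℝ)
    (hlam : ∀ a ∈ Set.Ioo (0 : ℝ) 1, ∀ n, 0 < ((M a n : ℕ)) →
      IsSmallestEig ((F n).subIK (M a n)) (lam a n))
    (u w : ℝ → ℕ → ℝ)
    (hu : ∀ a n, u a n = (F n).hitMean (M a n) 0)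
    (hw : ∀ a n, w a n = Real.sqrt ((F n).hitVar (M a n) 0))
    (hπ0 : Filter.Tendsto (fun n => (F n).pi 0) Filter.atTop (nhds 0))
    (hlazy : ∃ δ > (0 : ℝ), ∀ n, ∀ i : Fin (n + 1), δ ≤ (F n).K i i)
    (hgrow : ∃ a ∈ Set.Ioo (0 : ℝ) 1,
      Filter.Tendsto (fun n => u a n) Filter.atTop Filter.atTop) :
    -- (1) ↔ (2)
    (hasCutoff (fun ε n => ((mixD ((F n).dTV 0) ε : ℕ) : ℝ)) ↔
      (∀ a ∈ Set.Ioo (0 : ℝ) 1,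
        Filter.Tendsto (fun n => u a n / w a n) Filter.atTop Filter.atTop)) ∧
    -- (2) ↔ (3)
    ((∀ a ∈ Set.Ioo (0 : ℝ) 1,
        Filter.Tendsto (fun n => u a n / w a n) Filter.atTop Filter.atTop) ↔
      (∀ a ∈ Set.Ioo (0 : ℝ) 1,
        Filter.Tendsto (fun n => u a n * lam a n) Filter.atTop Filter.atTop)) ∧
    -- (1) ↔ (4)
    (hasCutoff (fun ε n => ((mixD ((F n).dTV 0) ε : ℕ) : ℝ)) ↔
      (∃ a ∈ Set.Ioo (0 : ℝ) 1, ∃ t : ℕ → ℝ, (∀ n, 0 < t n) ∧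
        (∀ c ∈ Set.Ioo (0 : ℝ) 1, ∃ C : ℝ, ∀ᶠ n in Filter.atTop, t n ≤ C * u c n) ∧
        (∀ ε ∈ Set.Ioo (0 : ℝ) 1,
          Filter.Tendsto (fun n => (F n).hitSurv (M a n) 0 ⌊(1 - ε) * t n⌋₊)
            Filter.atTop (nhds 1)) ∧
        (∀ b ∈ Set.Ioo a 1, ∃ αb ∈ Set.Ioo (0 : ℝ) 1, ∀ ε > (0 : ℝ),
          Filter.limsup (fun n => (F n).hitSurv (M b n) 0 ⌊(1 + ε) * t n⌋₊)
            Filter.atTop ≤ αb))) ∧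
    -- cutoff times under (2)
    ((∀ a ∈ Set.Ioo (0 : ℝ) 1,
        Filter.Tendsto (fun n => u a n / w a n) Filter.atTop Filter.atTop) →
      ∀ a ∈ Set.Ioo (0 : ℝ) 1,
        cutoffWith (fun ε n => ((mixD ((F n).dTV 0) ε : ℕ) : ℝ)) (u a)) ∧
    -- cutoff time under (4)
    (∀ a ∈ Set.Ioo (0 : ℝ) 1, ∀ t : ℕ → ℝ, (∀ n, 0 < t n) →
      (∀ c ∈ Set.Ioo (0 : ℝ) 1, ∃ C : ℝ, ∀ᶠ n in Filter.atTop, t n ≤ C * u c n) →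
      (∀ ε ∈ Set.Ioo (0 : ℝ) 1,
        Filter.Tendsto (fun n => (F n).hitSurv (M a n) 0 ⌊(1 - ε) * t n⌋₊)
          Filter.atTop (nhds 1)) →
      (∀ b ∈ Set.Ioo a 1, ∃ αb ∈ Set.Ioo (0 : ℝ) 1, ∀ ε > (0 : ℝ),
        Filter.limsup (fun n => (F n).hitSurv (M b n) 0 ⌊(1 + ε) * t n⌋₊)
          Filter.atTop ≤ αb) →
      cutoffWith (fun ε n => ((mixD ((F n).dTV 0) ε : ℕ) : ℝ)) t) := by
  obtain rfl : u = fun a n => (F n).hitMean (M a n) 0 := funext fun a => funext fun n => hu a n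
  obtain rfl : w = fun a n => Real.sqrt ((F n).hitVar (M a n) 0) :=
    funext fun a => funext fun n => hw a n
  obtain ⟨δ, hδ0, hδ⟩ := hlazy
  obtain ⟨a₀, ha₀, hgrow⟩ := hgrow
  have P := cutoffProfile_of_quantiles F M hM lam hlam hπ0 (δ := min δ (1 / 2))
    (lt_min hδ0 (by norm_num)) ((min_le_right _ _).trans_lt (by norm_num))
    (fun n i => (min_le_left _ _).trans (hδ n i))
  have h12 := fun h1 : (∀ a ∈ Set.Ioo (0 : ℝ) 1, Tendsto (fun n => (F n).hitMean (M a n) 0 /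
      Real.sqrt ((F n).hitVar (M a n) 0)) atTop atTop) => fun a ha => P.eig_of_var ha (h1 a ha)
  have h21 := fun h1 : (∀ a ∈ Set.Ioo (0 : ℝ) 1, Tendsto (fun n => (F n).hitMean (M a n) 0 *
      lam a n) atTop atTop) => fun a ha => P.var_of_eig ha (h1 a ha)
  have h14 : hasCutoff (fun ε n => ((mixD ((F n).dTV 0) ε : ℕ) : ℝ)) →
      ∃ a ∈ Set.Ioo (0 : ℝ) 1, ∃ t : ℕ → ℝ, (∀ n, 0 < t n) ∧
        (∀ c ∈ Set.Ioo (0 : ℝ) 1, ∃ C : ℝ, ∀ᶠ n in atTop, t n ≤ C * (F n).hitMean (M c n) 0) ∧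
        (∀ ε ∈ Set.Ioo (0 : ℝ) 1,
          Tendsto (fun n => (F n).hitSurv (M a n) 0 ⌊(1 - ε) * t n⌋₊) atTop (nhds 1)) ∧
        (∀ b ∈ Set.Ioo a 1, ∃ αb ∈ Set.Ioo (0 : ℝ) 1, ∀ ε > (0 : ℝ),
          limsup (fun n => (F n).hitSurv (M b n) 0 ⌊(1 + ε) * t n⌋₊) atTop ≤ αb) := by
    rintro ⟨t, ht0, ht⟩
    rw [P.cutoffWith_iff (Eventually.of_forall ht0)] at ht
    have htop := P.tendsto_time_of_sharpTransition ht ha₀ hgrow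
    refine ⟨a₀, ha₀, t, ht0, fun c hc => ⟨8, P.time_le_mean_of_sharpTransition ht htop hc⟩,
      fun ε hε => P.tendsto_surv_of_sharpTransition ht htop ha₀ hε, fun b hb => ?_⟩
    have hb' : b ∈ Set.Ioo (0 : ℝ) 1 := ⟨ha₀.1.trans hb.1, hb.2⟩
    exact ⟨b, hb', fun ε hε => P.limsup_surv_le_of_sharpTransition ht ht0 hb' hε⟩
  have h13 : hasCutoff (fun ε n => ((mixD ((F n).dTV 0) ε : ℕ) : ℝ)) →
      ∀ a ∈ Set.Ioo (0 : ℝ) 1,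
        Tendsto (fun n => (F n).hitMean (M a n) 0 * lam a n) atTop atTop := by
    intro h1
    obtain ⟨a, ha, t, ht0, hO, h2, h3⟩ := h14 h1
    exact (P.eig_of_surv ht0 ha₀ hgrow ha hO h2 h3).1
  refine ⟨⟨fun h1 => h21 (h13 h1), fun h2 => P.hasCutoff_of_eig (h12 h2)⟩, ⟨h12, h21⟩,
    ⟨h14, ?_⟩, fun h2 a ha => P.cutoffWith_mean (h12 h2) ha, ?_⟩
  · rintro ⟨a, ha, t, ht0, hO, h2, h3⟩
    exact ⟨t, ht0, P.cutoffWith_of_surv ht0 ha₀ hgrow ha hO h2 h3⟩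
  · exact fun a ha t ht0 hO h2 h3 => P.cutoffWith_of_surv ht0 ha₀ hgrow ha hO h2 h3

end
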